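/- arXiv:1111.2212 — 6 statements merged into one kernel-verified Lean document; each statement's English description precedes it below -/
import Mathlib

section
/- Let n ≥ 1. The elements t_n·u(y, z√ε − yȳ/2), where y runs over a set of representatives of o_E/p_E and z over a set of representatives of p_F^{1−n}/p_F^{2−n}, together with the elements u(a, b√ε − aā/2), where a runs over o_E/p_E and b over p_F^{−n}/p_F^{2−n}, form a complete set of representatives for the left coset space K_n / (K_n ∩ ζ·K_n·ζ^{-1}). -/
set_option autoImplicit false

open MeasureTheory Matrix

noncomputable section

/-- The 3×3 antidiagonal matrix `J`. -/
def J3mat (E : Type) [Field E] : Matrix (Fin 3) (Fin 3) E := !![0, 0, 1; 0, 1, 0; 1, 0, 0]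

/-- `G = U(2,1)(E/F) = {g ∈ GL₃(E) : ᵗḡ J g = J}`. -/
def GUset {E : Type} [Field E] (σ : E → E) : Set (Matrix (Fin 3) (Fin 3) E) :=
  {g | (g.map σ)ᵀ * J3mat E * g = J3mat E}

/-- The upper unipotent element `u(x,y)`. -/
def uM {E : Type} [Field E] (σ : E → E) (x y : E) : Matrix (Fin 3) (Fin 3) E :=
  !![1, x, y; 0, 1, -σ x; 0, 0, 1]

/-- The lower unipotent element `û(x,y)`. -/
def uhatM {E : Type} [Field E] (σ : E → E) (x y : E) : Matrix (Fin 3) (Fin 3) E :=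
  !![1, 0, 0; x, 1, 0; y, -σ x, 1]

/-- The open compact subgroup `K_n` of `G`. -/
def KUset {E : Type} [Field E] (q : ℝ) (σ : E → E) (absE : E → ℝ) (n : ℤ) :
    Set (Matrix (Fin 3) (Fin 3) E) :=
  {g | g ∈ GUset σ ∧ absE (g 0 0) ≤ 1 ∧ absE (g 0 1) ≤ 1 ∧ absE (g 0 2) ≤ (q ^ 2) ^ n ∧
    absE (g 1 0) ≤ (q ^ 2) ^ (-n) ∧ absE (g 1 1 - 1) ≤ (q ^ 2) ^ (-n) ∧ absE (g 1 2) ≤ 1 ∧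
    absE (g 2 0) ≤ (q ^ 2) ^ (-n) ∧ absE (g 2 1) ≤ (q ^ 2) ^ (-n) ∧ absE (g 2 2) ≤ 1}

/-- The element `t_n`, antidiagonal `(ϖ^{-n}, 1, ϖ^n)`. -/
def tUmat {E : Type} [Field E] (piE : E) (n : ℤ) : Matrix (Fin 3) (Fin 3) E :=
  !![0, 0, piE ^ (-n); 0, 1, 0; piE ^ n, 0, 0]

/-- The element `ζ = diag(ϖ, 1, ϖ⁻¹)`. -/
def zUmat {E : Type} [Field E] (piE : E) : Matrix (Fin 3) (Fin 3) E :=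
  !![piE, 0, 0; 0, 1, 0; 0, 0, piE⁻¹]

/-- The element `ζ⁻¹ = diag(ϖ⁻¹, 1, ϖ)`. -/
def zUinv {E : Type} [Field E] (piE : E) : Matrix (Fin 3) (Fin 3) E :=
  !![piE⁻¹, 0, 0; 0, 1, 0; 0, 0, piE]

/-- The congruence subgroup `Z_m` of the center `Z ≃ E^1` of `G`. -/
def ZUset {E : Type} [Field E] (q : ℝ) (σ : E → E) (absE : E → ℝ) (m : ℤ) :
    Set (Matrix (Fin 3) (Fin 3) E) :=
  {c | ∃ z : E, z * σ z = 1 ∧ absE (z - 1) ≤ (q ^ 2) ^ (-m) ∧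
    c = z • (1 : Matrix (Fin 3) (Fin 3) E)}

/-- `r : ι → E` is a complete set of representatives for `p_E^m / p_E^{m'}`. -/
def RepsE {E : Type} [Field E] (q : ℝ) (absE : E → ℝ) (m m' : ℤ) {ι : Type} (r : ι → E) : Prop :=
  (∀ i, absE (r i) ≤ (q ^ 2) ^ (-m)) ∧
  (∀ i j, absE (r i - r j) ≤ (q ^ 2) ^ (-m') → i = j) ∧
  (∀ x : E, absE x ≤ (q ^ 2) ^ (-m) → ∃ i, absE (x - r i) ≤ (q ^ 2) ^ (-m'))

/-- `r : ι → F` is a complete set of representatives for `p_F^m / p_F^{m'}`. -/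
def RepsF {F : Type} [Field F] (q : ℝ) (absF : F → ℝ) (m m' : ℤ) {ι : Type} (r : ι → F) : Prop :=
  (∀ i, absF (r i) ≤ q ^ (-m)) ∧
  (∀ i j, absF (r i - r j) ≤ q ^ (-m') → i = j) ∧
  (∀ x : F, absF x ≤ q ^ (-m) → ∃ i, absF (x - r i) ≤ q ^ (-m'))

/-- `r : ι → G` is a complete set of representatives for the left coset space `K/K₀`:
its members lie in `K`, in pairwise distinct left cosets of `K₀`, and every left coset
of `K₀` in `K` contains one of them. -/
def IsCompleteReps {E : Type} [Field E] {ι : Type}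
    (K K₀ : Set (Matrix (Fin 3) (Fin 3) E)) (r : ι → Matrix (Fin 3) (Fin 3) E) : Prop :=
  (∀ i, r i ∈ K) ∧
  (∀ i j, (∃ c ∈ K₀, r i * c = r j) → i = j) ∧
  (∀ g ∈ K, ∃ i, ∃ c ∈ K₀, g = r i * c)

/-- Abstract filtration of `E` by the powers of `p_E`. -/
structure Filt12 {E : Type} [Field E] (P : ℤ → E → Prop) (σ : E →+* E) (p : E) : Prop where
  add : ∀ m x y, P m x → P m y → P m (x + y)
  neg : ∀ m x, P m x → P m (-x)
  mul' : ∀ a b x y, P a x → P b y → P (a + b) (x * y)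
  conj : ∀ m x, P m x → P m (σ x)
  mono : ∀ a b x, b ≤ a → P a x → P b x
  zero : ∀ m, P m 0
  one : P 0 1
  none : ¬ P 1 1
  half : P 0 (2 : E)⁻¹
  two : (2 : E) ≠ 0
  unit : ∀ x, P 0 x → ¬ P 1 x → x ≠ 0 ∧ P 0 x⁻¹
  invol : ∀ x, σ (σ x) = x
  p0 : p ≠ 0
  pσ : σ p = p
  pP : ∀ m : ℤ, P m (p ^ m)

namespace Filt12

variable {E : Type} [Field E] {P : ℤ → E → Prop} {σ : E →+* E} {p : E}

theorem mul (h : Filt12 P σ p) {a b c : ℤ} {x y : E} (hx : P a x) (hy : P b y) (hc : c ≤ a + b) :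
    P c (x * y) := h.mono _ _ _ hc (h.mul' _ _ _ _ hx hy)

theorem sub (h : Filt12 P σ p) {a : ℤ} {x y : E} (hx : P a x) (hy : P a y) :
    P a (x - y) := by rw [sub_eq_add_neg]; exact h.add _ _ _ hx (h.neg _ _ hy)

/-- `K_n` in terms of the filtration. -/
def K (P : ℤ → E → Prop) (σ : E →+* E) (n : ℤ) : Set (Matrix (Fin 3) (Fin 3) E) :=
  {g | g ∈ GUset σ ∧ P 0 (g 0 0) ∧ P 0 (g 0 1) ∧ P (-n) (g 0 2) ∧
    P n (g 1 0) ∧ P n (g 1 1 - 1) ∧ P 0 (g 1 2) ∧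
    P n (g 2 0) ∧ P n (g 2 1) ∧ P 0 (g 2 2)}

/-- The intersection subgroup in terms of the filtration. -/
def K0 (P : ℤ → E → Prop) (σ : E →+* E) (n : ℤ) : Set (Matrix (Fin 3) (Fin 3) E) :=
  {g | g ∈ K P σ n ∧ P 1 (g 0 1) ∧ P (2 - n) (g 0 2) ∧ P 1 (g 1 2)}

theorem GU_mul {g k : Matrix (Fin 3) (Fin 3) E} (hg : g ∈ GUset σ) (hk : k ∈ GUset σ) :
    g * k ∈ GUset σ := by
  simp only [GUset, Set.mem_ofPred_eq] at *
  rw [Matrix.map_mul, Matrix.transpose_mul]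
  calc _ = (k.map σ)ᵀ * ((g.map σ)ᵀ * J3mat E * g) * k := by simp only [Matrix.mul_assoc]
    _ = _ := by rw [hg, hk]

theorem K_mul (h : Filt12 P σ p) {n : ℤ} (hn : 1 ≤ n) {g k : Matrix (Fin 3) (Fin 3) E}
    (hg : g ∈ K P σ n) (hk : k ∈ K P σ n) : g * k ∈ K P σ n := by
  obtain ⟨hg, g00, g01, g02, g10, g11, g12, g20, g21, g22⟩ := hg
  obtain ⟨hk, k00, k01, k02, k10, k11, k12, k20, k21, k22⟩ := hk
  have g11' : P 0 (g 1 1) := by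
    have := h.add _ _ _ (h.mono _ 0 _ (by omega) g11) h.one
    simpa using this
  have k11' : P 0 (k 1 1) := by
    have := h.add _ _ _ (h.mono _ 0 _ (by omega) k11) h.one
    simpa using this
  refine ⟨GU_mul hg hk, ?_, ?_, ?_, ?_, ?_, ?_, ?_, ?_, ?_⟩ <;>
    rw [Matrix.mul_apply, Fin.sum_univ_three]
  · exact h.add _ _ _ (h.add _ _ _ (h.mul g00 k00 (by omega)) (h.mul g01 k10 (by omega)))
      (h.mul g02 k20 (by omega))
  · exact h.add _ _ _ (h.add _ _ _ (h.mul g00 k01 (by omega)) (h.mul g01 k11' (by omega)))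
      (h.mul g02 k21 (by omega))
  · exact h.add _ _ _ (h.add _ _ _ (h.mul g00 k02 (by omega)) (h.mul g01 k12 (by omega)))
      (h.mul g02 k22 (by omega))
  · exact h.add _ _ _ (h.add _ _ _ (h.mul g10 k00 (by omega)) (h.mul g11' k10 (by omega)))
      (h.mul g12 k20 (by omega))
  · have e : g 1 0 * k 0 1 + g 1 1 * k 1 1 + g 1 2 * k 2 1 - 1 =
        g 1 0 * k 0 1 + ((g 1 1 - 1) * k 1 1 + (k 1 1 - 1)) + g 1 2 * k 2 1 := by ring
    rw [e]
    exact h.add _ _ _ (h.add _ _ _ (h.mul g10 k01 (by omega))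
      (h.add _ _ _ (h.mul g11 k11' (by omega)) k11)) (h.mul g12 k21 (by omega))
  · exact h.add _ _ _ (h.add _ _ _ (h.mul g10 k02 (by omega)) (h.mul g11' k12 (by omega)))
      (h.mul g12 k22 (by omega))
  · exact h.add _ _ _ (h.add _ _ _ (h.mul g20 k00 (by omega)) (h.mul g21 k10 (by omega)))
      (h.mul g22 k20 (by omega))
  · exact h.add _ _ _ (h.add _ _ _ (h.mul g20 k01 (by omega)) (h.mul g21 k11' (by omega)))
      (h.mul g22 k21 (by omega))
  · exact h.add _ _ _ (h.add _ _ _ (h.mul g20 k02 (by omega)) (h.mul g21 k12 (by omega)))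
      (h.mul g22 k22 (by omega))

theorem u_mem (h : Filt12 P σ p) {n : ℤ} (x y : E) (hx : P 0 x) (hy : P (-n) y)
    (e : y + σ y + x * σ x = 0) : uM σ x y ∈ K P σ n := by
  refine ⟨?_, ?_, ?_, ?_, ?_, ?_, ?_, ?_, ?_, ?_⟩
  · simp only [GUset, Set.mem_ofPred_eq]
    ext i j
    fin_cases i <;> fin_cases j <;>
      simp [uM, J3mat, Matrix.mul_apply, Fin.sum_univ_three, h.invol]
    linear_combination e
  all_goals simp [uM, hx, hy, h.one, h.zero]
  exact h.neg _ _ (h.conj _ _ hx)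

theorem t_mem (h : Filt12 P σ p) (n : ℤ) : tUmat p n ∈ K P σ n := by
  have hp := h.p0
  have hpn := zpow_ne_zero n hp
  refine ⟨?_, ?_, ?_, ?_, ?_, ?_, ?_, ?_, ?_, ?_⟩
  · simp only [GUset, Set.mem_ofPred_eq]
    ext i j
    fin_cases i <;> fin_cases j <;>
      simp [tUmat, J3mat, Matrix.mul_apply, Fin.sum_univ_three, h.pσ, hp, hpn]
  all_goals simp [tUmat, h.one, h.zero]
  · have := h.pP (-n); rwa [_root_.zpow_neg] at this
  · exact h.pP n

theorem t_t (h : Filt12 P σ p) (n : ℤ) : tUmat p n * tUmat p n = 1 := by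
  have hp := h.p0
  have hpn := zpow_ne_zero n hp
  ext i j
  fin_cases i <;> fin_cases j <;>
    simp [tUmat, Matrix.mul_apply, Fin.sum_univ_three, hp, hpn]

theorem u_u (h : Filt12 P σ p) (a B : E) :
    uM σ a (B - a * σ a / 2) * uM σ (-a) (-B - a * σ a / 2) = 1 := by
  have h2 := h.two
  ext i j
  fin_cases i <;> fin_cases j <;>
    simp [uM, Matrix.mul_apply, Fin.sum_univ_three]
  field_simp
  ring

theorem u_u' (h : Filt12 P σ p) (a B : E) :
    uM σ (-a) (-B - a * σ a / 2) * uM σ a (B - a * σ a / 2) = 1 := by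
  have := h.u_u (-a) (-B)
  simpa using this

theorem u_mem' (h : Filt12 P σ p) {n : ℤ} (hn : 1 ≤ n) (a B : E) (ha : P 0 a) (hB : P (-n) B)
    (e : σ B = -B) : uM σ a (B - a * σ a / 2) ∈ K P σ n := by
  have h2 := h.two
  apply h.u_mem _ _ ha
  · apply h.sub hB
    rw [div_eq_mul_inv]
    exact h.mul (h.mul ha (h.conj _ _ ha) (le_refl _)) h.half (by omega)
  · simp only [map_sub, map_div₀, map_mul, h.invol, e, map_ofNat]
    field_simp
    ring

theorem u_inv_mem (h : Filt12 P σ p) {n : ℤ} (hn : 1 ≤ n) (a B : E) (ha : P 0 a) (hB : P (-n) B)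
    (e : σ B = -B) : uM σ (-a) (-B - a * σ a / 2) ∈ K P σ n := by
  have := h.u_mem' hn (-a) (-B) (h.neg _ _ ha) (h.neg _ _ hB) (by simp [e])
  simpa using this

/-- Representatives of skew elements. -/
structure Sk (P : ℤ → E → Prop) (σ : E →+* E) (m m' : ℤ) {ι : Type} (Z : ι → E) : Prop where
  skew : ∀ i, σ (Z i) = - Z i
  mem : ∀ i, P m (Z i)
  inj : ∀ i j, P m' (Z i - Z j) → i = j
  surj : ∀ x, σ x = -x → P m x → ∃ i, P m' (x - Z i)

/-- Representatives of `o_E/p_E`. -/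
structure Rp (P : ℤ → E → Prop) {ι : Type} (Y : ι → E) : Prop where
  mem : ∀ i, P 0 (Y i)
  inj : ∀ i j, P 1 (Y i - Y j) → i = j
  surj : ∀ x, P 0 x → ∃ i, P 1 (x - Y i)

theorem cell (h : Filt12 P σ p) {n : ℤ} (hn : 1 ≤ n) {g : Matrix (Fin 3) (Fin 3) E}
    (hg : g ∈ K P σ n) (hu : ¬ P 1 (g 2 2)) {j : ℤ} (hj : j ≤ 0) (hjn : -n ≤ j) (hgj : P j (g 0 2))
    {ι κ : Type} {Y : ι → E} {Z : κ → E} (hY : Rp P Y) (hZ : Sk P σ j (2 - n) Z) :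
    ∃ i k, ∃ c ∈ K0 P σ n, g = uM σ (Y i) (Z k - Y i * σ (Y i) / 2) * c := by
  have h2 := h.two
  have hg' := hg
  obtain ⟨hG, g00, g01, g02, g10, g11, g12, g20, g21, g22⟩ := hg
  obtain ⟨w0, winv⟩ := h.unit _ g22 hu
  have σw0 : σ (g 2 2) ≠ 0 := by simpa using w0
  have iso := congrFun (congrFun hG 2) 2
  simp [J3mat, Matrix.mul_apply, Fin.sum_univ_three] at iso
  obtain ⟨s, hs⟩ : ∃ s, s = g 0 2 * (g 2 2)⁻¹ := ⟨_, rfl⟩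
  obtain ⟨r, hr⟩ : ∃ r, r = g 1 2 * (g 2 2)⁻¹ := ⟨_, rfl⟩
  have es : g 0 2 = s * g 2 2 := by rw [hs]; field_simp
  have er : g 1 2 = r * g 2 2 := by rw [hr]; field_simp
  have Ps : P j s := hs ▸ h.mul hgj winv (by omega)
  have Pr : P 0 r := hr ▸ h.mul g12 winv (by omega)
  have isr : s + σ s + r * σ r = 0 := by
    rw [es, er] at iso
    simp only [map_mul] at iso
    have : (s + σ s + r * σ r) * (g 2 2 * σ (g 2 2)) = 0 := by linear_combination iso
    simpa [w0, σw0] using this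
  obtain ⟨i, hi⟩ := hY.surj (-σ r) (h.neg _ _ (h.conj _ _ Pr))
  have ha := hY.mem i
  obtain ⟨a, haa⟩ : ∃ a, a = Y i := ⟨_, rfl⟩
  rw [← haa] at hi ha
  obtain ⟨X, hX⟩ : ∃ X, X = s + (r * σ r + (σ a * σ r - a * r)) * 2⁻¹ := ⟨_, rfl⟩
  have PX : P j X := by
    rw [hX]
    apply h.add _ _ _ Ps
    refine h.mono 0 _ _ hj (h.mul (a := 0) (b := 0) ?_ h.half (by omega))
    exact h.add _ _ _ (h.mul Pr (h.conj _ _ Pr) (by omega))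
      (h.sub (h.mul (h.conj _ _ ha) (h.conj _ _ Pr) (by omega)) (h.mul ha Pr (by omega)))
  have sX : σ X = -X := by
    rw [hX]
    simp only [map_add, map_mul, map_sub, map_inv₀, map_ofNat, h.invol]
    field_simp
    linear_combination 2 * isr
  obtain ⟨k, hk⟩ := hZ.surj X sX PX
  have hB := hZ.mem k
  have sB := hZ.skew k
  refine ⟨i, k, uM σ (-Y i) (-Z k - Y i * σ (Y i) / 2) * g, ?_, ?_⟩
  swap
  · rw [← Matrix.mul_assoc, h.u_u, Matrix.one_mul]
  rw [← haa]
  generalize Z k = B at *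
  have hcK : uM σ (-a) (-B - a * σ a / 2) * g ∈ K P σ n :=
    h.K_mul hn (h.u_inv_mem hn a B ha (h.mono _ _ _ hjn hB) sB) hg'
  have c02 : (uM σ (-a) (-B - a * σ a / 2) * g) 0 2
      = ((X - B) - (σ a + r) * (a + σ r) * 2⁻¹) * g 2 2 := by
    simp [Matrix.mul_apply, Fin.sum_univ_three, uM]
    rw [hX, es, er]
    field_simp
    ring
  have c12 : (uM σ (-a) (-B - a * σ a / 2) * g) 1 2 = (σ a + r) * g 2 2 := by
    simp [Matrix.mul_apply, Fin.sum_univ_three, uM]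
    rw [er]; ring
  have c22 : (uM σ (-a) (-B - a * σ a / 2) * g) 2 2 = g 2 2 := by
    simp [Matrix.mul_apply, Fin.sum_univ_three, uM]
  have q1 : P 1 (a + σ r) := by
    have := h.neg _ _ hi
    convert this using 1; ring
  have q2 : P 1 (σ a + r) := by
    have := h.conj _ _ q1
    simpa [h.invol] using this
  have p02 : P (2 - n) ((uM σ (-a) (-B - a * σ a / 2) * g) 0 2) := by
    rw [c02]
    refine h.mul (a := 2 - n) (b := 0) (h.sub hk ?_) g22 (by omega)
    exact h.mul (a := 2) (b := 0) (h.mul q2 q1 (by omega)) h.half (by omega)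
  have p12 : P 1 ((uM σ (-a) (-B - a * σ a / 2) * g) 1 2) := by
    rw [c12]; exact h.mul q2 g22 (by omega)
  generalize uM σ (-a) (-B - a * σ a / 2) * g = c at *
  refine ⟨hcK, ?_, p02, p12⟩
  obtain ⟨hC, d00, d01, d02, d10, d11, d12, d20, d21, d22⟩ := hcK
  have d11' : P 0 (c 1 1) := by
    have := h.add _ _ _ (h.mono _ 0 _ (by omega) d11) h.one
    simpa using this
  have iso2 := congrFun (congrFun hC 2) 1
  simp [J3mat, Matrix.mul_apply, Fin.sum_univ_three] at iso2
  have : c 0 1 = -(σ (c 1 2) * c 1 1 + σ (c 0 2) * c 2 1) * σ ((g 2 2)⁻¹) := by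
    rw [c22] at iso2
    rw [map_inv₀]
    field_simp
    linear_combination iso2
  rw [this]
  refine h.mul (a := 1) (b := 0) (h.neg _ _ (h.add _ _ _ ?_ ?_)) (h.conj _ _ winv) (by omega)
  · exact h.mul (h.conj _ _ p12) d11' (by omega)
  · exact h.mul (h.conj _ _ p02) d21 (by omega)

theorem uu_inj (h : Filt12 P σ p) {n : ℤ} {j : ℤ}
    {ι κ : Type} {Y : ι → E} {Z : κ → E} (hY : Rp P Y) (hZ : Sk P σ j (2 - n) Z)
    {c : Matrix (Fin 3) (Fin 3) E} (hc : c ∈ K0 P σ n) (i i' : ι) (k k' : κ)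
    (e : uM σ (Y i) (Z k - Y i * σ (Y i) / 2) * c = uM σ (Y i') (Z k' - Y i' * σ (Y i') / 2)) :
    i = i' ∧ k = k' := by
  have h2 := h.two
  have hce : c = uM σ (-Y i) (-Z k - Y i * σ (Y i) / 2) *
      uM σ (Y i') (Z k' - Y i' * σ (Y i') / 2) := by
    rw [← e, ← Matrix.mul_assoc, h.u_u', Matrix.one_mul]
  obtain ⟨-, c01, c02, c12⟩ := hc
  have e01 : c 0 1 = Y i' - Y i := by
    rw [hce]; simp [Matrix.mul_apply, Fin.sum_univ_three, uM]; ring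
  rw [e01] at c01
  have hi := hY.inj _ _ c01
  subst hi
  refine ⟨rfl, ?_⟩
  have e02 : c 0 2 = Z k' - Z k := by
    rw [hce]; simp [Matrix.mul_apply, Fin.sum_univ_three, uM]
    field_simp
    ring
  rw [e02] at c02
  exact (hZ.inj _ _ c02).symm

theorem not_pn (h : Filt12 P σ p) (n : ℤ) (x : E) (hx : P (1 - n) x) :
    ¬ P (2 - n) (p ^ (-n) + x) := by
  intro hh
  have h1 : P (1 - n) (p ^ (-n)) := by
    have := h.sub (h.mono _ (1 - n) _ (by omega) hh) hx
    simpa using this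
  have := h.mul (c := 1) h1 (h.pP n) (by omega)
  rw [← zpow_add₀ h.p0] at this
  simp at this
  exact h.none this

/-- The cross term: `u⁻¹ t u'` is not in the small subgroup. -/
theorem cross (h : Filt12 P σ p) {n : ℤ} (hn : 1 ≤ n) (a B a' B' : E) (j j' : ℤ)
    (ha : P 0 a) (ha' : P 0 a') (hB : P j B) (hB' : P j' B') (hj : j ≤ 0) (hj' : j' ≤ 0)
    (hjj : 1 - 2 * n ≤ j + j') :
    uM σ (-a) (-B - a * σ a / 2) * (tUmat p n * uM σ a' (B' - a' * σ a' / 2)) ∉ K0 P σ n := by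
  rintro ⟨-, -, c02, -⟩
  have e : (uM σ (-a) (-B - a * σ a / 2) * (tUmat p n * uM σ a' (B' - a' * σ a' / 2))) 0 2
    = p ^ (-n) + (a * σ a' + (-B - a * σ a * 2⁻¹) * (B' - a' * σ a' * 2⁻¹) * p ^ n) := by
    simp [Matrix.mul_apply, Fin.sum_univ_three, uM, tUmat, div_eq_mul_inv]
    ring
  rw [e] at c02
  refine h.not_pn n _ ?_ c02
  refine h.add _ _ _ (h.mul ha (h.conj _ _ ha') (by omega)) ?_
  refine h.mul (a := j + j') (b := n) (h.mul (a := j) (b := j') ?_ ?_ le_rfl) (h.pP n) (by omega)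
  · exact h.sub (h.neg _ _ hB) (h.mul (h.mul ha (h.conj _ _ ha) le_rfl) h.half (by omega))
  · exact h.sub hB' (h.mul (h.mul ha' (h.conj _ _ ha') le_rfl) h.half (by omega))

theorem main (h : Filt12 P σ p) {n : ℤ} (hn : 1 ≤ n)
    {ι κ τ : Type} {Y : ι → E} {Z : κ → E} {B : τ → E} (hY : Rp P Y)
    (hZ : Sk P σ (1 - n) (2 - n) Z) (hB : Sk P σ (-n) (2 - n) B) :
    IsCompleteReps (K P σ n) (K0 P σ n) (Sum.elim
      (fun p' : ι × κ => tUmat p n * uM σ (Y p'.1) (Z p'.2 - Y p'.1 * σ (Y p'.1) / 2))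
      (fun p' : ι × τ => uM σ (Y p'.1) (B p'.2 - Y p'.1 * σ (Y p'.1) / 2))) := by
  refine ⟨?_, ?_, ?_⟩
  · rintro (⟨i, k⟩ | ⟨i, k⟩)
    · exact h.K_mul hn (h.t_mem n) (h.u_mem' hn _ _ (hY.mem _)
        (h.mono _ _ _ (by omega) (hZ.mem _)) (hZ.skew _))
    · exact h.u_mem' hn _ _ (hY.mem _) (hB.mem _) (hB.skew _)
  · rintro (⟨i, k⟩ | ⟨i, k⟩) (⟨i', k'⟩ | ⟨i', k'⟩) ⟨c, hc, e⟩ <;>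
      simp only [Sum.elim_inl, Sum.elim_inr] at e
    · have e' := congrArg (tUmat p n * ·) e
      simp only [← Matrix.mul_assoc, h.t_t, Matrix.one_mul] at e'
      obtain ⟨rfl, rfl⟩ := h.uu_inj hY hZ hc _ _ _ _ e'
      rfl
    · exfalso
      have e' := congrArg (tUmat p n * ·) e
      simp only [← Matrix.mul_assoc, h.t_t, Matrix.one_mul] at e'
      have e2 := congrArg (uM σ (-Y i) (-Z k - Y i * σ (Y i) / 2) * ·) e'
      simp only [← Matrix.mul_assoc, h.u_u', Matrix.one_mul] at e2
      rw [Matrix.mul_assoc] at e2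
      rw [e2] at hc
      exact h.cross hn _ _ _ _ _ _ (hY.mem _) (hY.mem _) (hZ.mem _) (hB.mem _)
        (by omega) (by omega) (by omega) hc
    · exfalso
      have e2 := congrArg (uM σ (-Y i) (-B k - Y i * σ (Y i) / 2) * ·) e
      simp only [← Matrix.mul_assoc, h.u_u', Matrix.one_mul] at e2
      rw [Matrix.mul_assoc] at e2
      rw [e2] at hc
      exact h.cross hn _ _ _ _ _ _ (hY.mem _) (hY.mem _) (hB.mem _) (hZ.mem _)
        (by omega) (by omega) (by omega) hc
    · obtain ⟨rfl, rfl⟩ := h.uu_inj hY hB hc _ _ _ _ e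
      rfl
  · intro g hg
    by_cases hu : P 1 (g 2 2)
    · have htg := h.K_mul hn (h.t_mem n) hg
      have t22 : (tUmat p n * g) 2 2 = p ^ n * g 0 2 := by
        simp [Matrix.mul_apply, Fin.sum_univ_three, tUmat]
      have t02 : (tUmat p n * g) 0 2 = p ^ (-n) * g 2 2 := by
        simp [Matrix.mul_apply, Fin.sum_univ_three, tUmat]
      have hu' : ¬ P 1 ((tUmat p n * g) 2 2) := by
        rw [t22]
        intro hp
        obtain ⟨hG, g00, g01, g02, g10, g11, g12, g20, g21, g22⟩ := hg
        have iso := congrFun (congrFun hG 0) 2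
        simp [J3mat, Matrix.mul_apply, Fin.sum_univ_three] at iso
        apply h.none
        rw [← iso]
        have hp' : P (1 - n) (g 0 2) := by
          have := h.mul (c := 1 - n) (h.pP (-n)) hp (by omega)
          rwa [← mul_assoc, ← zpow_add₀ h.p0, neg_add_cancel, zpow_zero, one_mul] at this
        exact h.add _ _ _ (h.add _ _ _ (h.mul (h.conj _ _ g20) hp' (by omega))
          (h.mul (h.conj _ _ g10) g12 (by omega))) (h.mul (h.conj _ _ g00) hu (by omega))
      obtain ⟨i, k, c, hc, e⟩ := h.cell hn htg hu' (j := 1 - n) (by omega) (by omega)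
        (by rw [t02]; exact h.mul (h.pP _) hu (by omega)) hY hZ
      refine ⟨Sum.inl (i, k), c, hc, ?_⟩
      simp only [Sum.elim_inl]
      rw [Matrix.mul_assoc, ← e, ← Matrix.mul_assoc, h.t_t, Matrix.one_mul]
    · obtain ⟨i, k, c, hc, e⟩ := h.cell hn hg hu (j := -n) (by omega) le_rfl hg.2.2.2.1 hY hB
      exact ⟨Sum.inr (i, k), c, hc, e⟩

theorem K0_eq (h : Filt12 P σ p) (n : ℤ) :
    K P σ n ∩ {m | ∃ k ∈ K P σ n, m = zUmat p * k * zUinv p} = K0 P σ n := by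
  have hp := h.p0
  have hpn := zpow_ne_zero n hp
  have p1 : P 1 p := by simpa using h.pP 1
  have pm1 : P (-1) p⁻¹ := by simpa using h.pP (-1)
  ext g
  constructor
  · rintro ⟨hg, k, ⟨-, k00, k01, k02, k10, k11, k12, k20, k21, k22⟩, rfl⟩
    refine ⟨hg, ?_, ?_, ?_⟩ <;>
      simp only [Matrix.mul_apply, Fin.sum_univ_three, zUmat, zUinv] <;> simp
    · exact h.mul p1 k01 (by omega)
    · exact h.mul (h.mul p1 k02 le_rfl) p1 (by omega)
    · exact h.mul k12 p1 (by omega)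
  · rintro ⟨hg, c01, c02, c12⟩
    refine ⟨hg, zUinv p * g * zUmat p, ?_, ?_⟩
    · obtain ⟨hG, g00, g01, g02, g10, g11, g12, g20, g21, g22⟩ := hg
      have hz : zUmat p ∈ GUset σ := by
        simp only [GUset, Set.mem_ofPred_eq]
        ext i j
        fin_cases i <;> fin_cases j <;>
          simp [zUmat, J3mat, Matrix.mul_apply, Fin.sum_univ_three, h.pσ, hp, hpn]
      have hz' : zUinv p ∈ GUset σ := by
        simp only [GUset, Set.mem_ofPred_eq]
        ext i j
        fin_cases i <;> fin_cases j <;>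
          simp [zUinv, J3mat, Matrix.mul_apply, Fin.sum_univ_three, h.pσ, hp, hpn]
      refine ⟨GU_mul (GU_mul hz' hG) hz, ?_, ?_, ?_, ?_, ?_, ?_, ?_, ?_, ?_⟩ <;>
        simp only [Matrix.mul_apply, Fin.sum_univ_three, zUmat, zUinv] <;> simp
      · exact h.mul (h.mul pm1 g00 le_rfl) p1 (by omega)
      · exact h.mul pm1 c01 (by omega)
      · exact h.mul (h.mul pm1 c02 le_rfl) pm1 (by omega)
      · exact h.mul g10 p1 (by omega)
      · exact g11
      · exact h.mul c12 pm1 (by omega)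
      · exact h.mul (h.mul p1 g20 le_rfl) p1 (by omega)
      · exact h.mul p1 g21 (by omega)
      · exact h.mul (h.mul p1 g22 le_rfl) pm1 (by omega)
    · have e1 : zUmat p * zUinv p = 1 := by
        ext i j
        fin_cases i <;> fin_cases j <;>
          simp [zUmat, zUinv, Matrix.mul_apply, Fin.sum_univ_three, hp, hpn]
      calc g = (zUmat p * zUinv p) * g * (zUmat p * zUinv p) := by rw [e1]; simp
        _ = _ := by simp only [Matrix.mul_assoc]

end Filt12

set_option maxHeartbeats 200000 in
/-- Lemma 4.1: the listed elements form a complete set of representatives for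
`K_n / (K_n ∩ ζ K_n ζ⁻¹)`. -/
theorem stmt_12
    (F : Type) [Field F] [CharZero F]
    (q : ℝ) (hq : 1 < q)
    (absF : F → ℝ)
    (habsF0 : ∀ x : F, absF x = 0 ↔ x = 0)
    (habsFmul : ∀ x y : F, absF (x * y) = absF x * absF y)
    (habsFadd : ∀ x y : F, absF (x + y) ≤ max (absF x) (absF y))
    (ϖ : F) (hϖ : absF ϖ = q⁻¹)
    (hvalF : ∀ x : F, x ≠ 0 → ∃ m : ℤ, absF x = q ^ m)
    (habsF2 : absF 2 = 1)
    (E : Type) [Field E] [Algebra F E]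
    (σ : E → E)
    (hσadd : ∀ x y : E, σ (x + y) = σ x + σ y)
    (hσmul : ∀ x y : E, σ (x * y) = σ x * σ y)
    (hσinvol : ∀ x : E, σ (σ x) = x)
    (hσfix : ∀ x : F, σ (algebraMap F E x) = algebraMap F E x)
    (ε : F) (sqrtε : E)
    (hεabs : absF ε = 1)
    (hεnonsq : ∀ a : F, a * a ≠ ε)
    (hsqrtε : sqrtε * sqrtε = algebraMap F E ε)
    (hσsqrtε : σ sqrtε = -sqrtε)
    (hspan : ∀ x : E, ∃ a b : F, x = algebraMap F E a + algebraMap F E b * sqrtε)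
    (absE : E → ℝ)
    (habsE0 : ∀ x : E, absE x = 0 ↔ x = 0)
    (habsEmul : ∀ x y : E, absE (x * y) = absE x * absE y)
    (habsEadd : ∀ x y : E, absE (x + y) ≤ max (absE x) (absE y))
    (habsEF : ∀ x : F, absE (algebraMap F E x) = absF x ^ 2)
    (habsEconj : ∀ x : E, absE (σ x) = absE x)
    (habsEspan : ∀ a b : F,
      absE (algebraMap F E a + algebraMap F E b * sqrtε) = max (absF a ^ 2) (absF b ^ 2))
    (hvalE : ∀ x : E, x ≠ 0 → ∃ m : ℤ, absE x = (q ^ 2) ^ m)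
    (n : ℤ) (hn : 1 ≤ n)
    (ι₁ ι₂ ι₃ : Type)
    (yr : ι₁ → E) (hyr : RepsE q absE 0 1 yr)
    (zr : ι₂ → F) (hzr : RepsF q absF (1 - n) (2 - n) zr)
    (br : ι₃ → F) (hbr : RepsF q absF (-n) (2 - n) br)
    (reps : (ι₁ × ι₂) ⊕ (ι₁ × ι₃) → Matrix (Fin 3) (Fin 3) E)
    (hreps : reps = Sum.elim
      (fun p => tUmat (algebraMap F E ϖ) n *
        uM σ (yr p.1) (algebraMap F E (zr p.2) * sqrtε - yr p.1 * σ (yr p.1) / 2))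
      (fun p => uM σ (yr p.1)
        (algebraMap F E (br p.2) * sqrtε - yr p.1 * σ (yr p.1) / 2))) :
    IsCompleteReps (KUset q σ absE n)
      (KUset q σ absE n ∩
        {m | ∃ k ∈ KUset q σ absE n,
          m = zUmat (algebraMap F E ϖ) * k * zUinv (algebraMap F E ϖ)})
      reps := by
  have hQ : (1 : ℝ) < q ^ 2 := by nlinarith
  have hQ0 : (0 : ℝ) < q ^ 2 := by linarith
  have hq0 : (0 : ℝ) < q := by linarith
  have inj := (algebraMap F E).injective
  have σ0 : σ 0 = 0 := by simpa using hσfix 0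
  have σ1 : σ 1 = 1 := by simpa using hσfix 1
  obtain ⟨τ, hτ⟩ : ∃ τ : E →+* E, ∀ x, τ x = σ x :=
    ⟨{ toFun := σ, map_one' := σ1, map_mul' := hσmul, map_zero' := σ0, map_add' := hσadd },
      fun _ => rfl⟩
  obtain rfl : σ = ⇑τ := funext fun x => (hτ x).symm
  have absE_nonneg : ∀ x, 0 ≤ absE x := by
    intro x
    by_cases hx : x = 0
    · rw [(habsE0 x).2 hx]
    · obtain ⟨m, hm⟩ := hvalE x hx
      rw [hm]; positivity
  have absF_nonneg : ∀ x, 0 ≤ absF x := by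
    intro x
    by_cases hx : x = 0
    · rw [(habsF0 x).2 hx]
    · obtain ⟨m, hm⟩ := hvalF x hx
      rw [hm]; positivity
  have absF1 : absF 1 = 1 := by
    have h1 := habsFmul 1 1
    have h2 : absF 1 ≠ 0 := by rw [Ne, habsF0]; exact one_ne_zero
    rw [mul_one] at h1
    exact (mul_eq_left₀ h2).1 h1.symm
  have absE1 : absE 1 = 1 := by simpa [absF1] using habsEF 1
  have absEm1 : absE (-1) = 1 := by
    have h1 := habsEmul (-1) (-1)
    rw [neg_mul_neg, one_mul, absE1] at h1
    have h2 := absE_nonneg (-1)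
    nlinarith
  have absEneg : ∀ x, absE (-x) = absE x := by
    intro x
    rw [← neg_one_mul, habsEmul, absEm1, one_mul]
  have absE2 : absE 2 = 1 := by
    have := habsEF 2
    rw [habsF2, map_ofNat] at this
    simpa using this
  have absEinv : ∀ x, x ≠ 0 → absE x⁻¹ = (absE x)⁻¹ := by
    intro x hx
    apply eq_inv_of_mul_eq_one_left
    rw [← habsEmul, inv_mul_cancel₀ hx, absE1]
  have two0 : (2 : E) ≠ 0 := by
    intro h; rw [h, (habsE0 0).2 rfl] at absE2; exact zero_ne_one absE2
  have ϖ0 : ϖ ≠ 0 := by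
    rw [Ne, ← habsF0, hϖ]; positivity
  have p0 : algebraMap F E ϖ ≠ 0 := by simpa using ϖ0
  have absp : absE (algebraMap F E ϖ) = (q ^ 2)⁻¹ := by rw [habsEF, hϖ, inv_pow]
  have abspz : ∀ m : ℤ, absE (algebraMap F E ϖ ^ m) = (q ^ 2) ^ (-m) := by
    let f : E →*₀ ℝ := { toFun := absE, map_one' := absE1, map_mul' := habsEmul,
                         map_zero' := (habsE0 0).2 rfl }
    intro m
    have h1 : f (algebraMap F E ϖ ^ m) = f (algebraMap F E ϖ) ^ m := map_zpow₀ f _ _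
    have h2 : f (algebraMap F E ϖ) = (q ^ 2)⁻¹ := absp
    rw [h2, _root_.inv_zpow'] at h1
    exact h1
  obtain ⟨P, hP⟩ : ∃ P : ℤ → E → Prop, ∀ m x, P m x ↔ absE x ≤ (q ^ 2) ^ (-m) :=
    ⟨fun m x => absE x ≤ (q ^ 2) ^ (-m), fun _ _ => Iff.rfl⟩
  have H : Filt12 P τ (algebraMap F E ϖ) := by
    refine ⟨?_, ?_, ?_, ?_, ?_, ?_, ?_, ?_, ?_, two0, ?_, hσinvol, p0, hσfix ϖ, ?_⟩
    · intro m x y hx hy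
      rw [hP] at *
      exact (habsEadd x y).trans (max_le hx hy)
    · intro m x hx
      rw [hP] at *
      rwa [absEneg]
    · intro a b x y hx hy
      rw [hP] at *
      rw [habsEmul, neg_add, zpow_add₀ hQ0.ne']
      exact mul_le_mul hx hy (absE_nonneg _) (by positivity)
    · intro m x hx
      rw [hP] at *
      rwa [habsEconj]
    · intro a b x hab hx
      rw [hP] at *
      exact hx.trans (zpow_le_zpow_right₀ hQ.le (by omega))
    · intro m
      rw [hP, (habsE0 0).2 rfl]; positivity
    · rw [hP, absE1]; simp
    · rw [hP, absE1, not_le]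
      rw [_root_.zpow_neg_one]
      exact inv_lt_one_of_one_lt₀ hQ
    · rw [hP, absEinv _ two0, absE2]; simp
    · intro x hx hnx
      rw [hP] at hx hnx
      have hx0 : x ≠ 0 := by
        rintro rfl
        apply hnx
        rw [(habsE0 0).2 rfl]; positivity
      refine ⟨hx0, ?_⟩
      rw [hP, absEinv _ hx0]
      obtain ⟨m, hm⟩ := hvalE x hx0
      rw [hm] at hnx ⊢
      rw [zpow_le_zpow_iff_right₀ hQ] at hnx
      rw [← _root_.zpow_neg, zpow_le_zpow_iff_right₀ hQ]
      omega
    · intro m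
      rw [hP, abspz]
  have hKeq : KUset q τ absE n = Filt12.K P τ n := by
    ext g
    simp only [KUset, Filt12.K, Set.mem_ofPred_eq, hP, neg_neg, neg_zero, zpow_zero]
  have hY : Filt12.Rp P yr := by
    obtain ⟨h1, h2, h3⟩ := hyr
    refine ⟨?_, ?_, ?_⟩
    · simpa only [hP] using h1
    · simpa only [hP] using h2
    · simpa only [hP] using h3
  have absb : ∀ b : F, absE (algebraMap F E b * sqrtε) = absF b ^ 2 := by
    intro b
    have := habsEspan 0 b
    rw [map_zero, zero_add, (habsF0 0).2 rfl] at this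
    rw [this]
    apply max_eq_right
    simp only [ne_eq, OfNat.ofNat_ne_zero, not_false_eq_true, zero_pow]
    positivity
  have Pb : ∀ (m : ℤ) (b : F), P m (algebraMap F E b * sqrtε) ↔ absF b ≤ q ^ (-m) := by
    intro m b
    rw [hP, absb]
    have : (q ^ 2) ^ (-m) = (q ^ (-m)) ^ 2 := by
      rw [← zpow_natCast, ← zpow_natCast, ← _root_.zpow_mul, ← _root_.zpow_mul, mul_comm]
    rw [this]
    exact pow_le_pow_iff_left₀ (absF_nonneg b) (by positivity) two_ne_zero
  have hS : ∀ (m m' : ℤ) (κ : Type) (r : κ → F), RepsF q absF m m' r →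
      Filt12.Sk P τ m m' (fun i => algebraMap F E (r i) * sqrtε) := by
    rintro m m' κ r ⟨h1, h2, h3⟩
    refine ⟨?_, ?_, ?_, ?_⟩
    · intro i
      rw [hσmul, hσfix, hσsqrtε]; ring
    · intro i
      rw [Pb]; exact h1 i
    · intro i j hij
      rw [← sub_mul, ← map_sub, Pb] at hij
      exact h2 i j hij
    · intro x hx hxm
      obtain ⟨a, b, rfl⟩ := hspan x
      rw [hσadd, hσmul, hσfix, hσfix, hσsqrtε] at hx
      have ha : algebraMap F E a = 0 := by
        have : 2 * algebraMap F E a = 0 := by linear_combination hx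
        simpa [two0] using this
      rw [ha, zero_add] at hxm ⊢
      rw [Pb] at hxm
      obtain ⟨i, hi⟩ := h3 b hxm
      refine ⟨i, ?_⟩
      rw [← sub_mul, ← map_sub, Pb]
      exact hi
  have hZ := hS _ _ _ _ hzr
  have hB := hS _ _ _ _ hbr
  have M := H.main hn hY hZ hB
  rw [hKeq, H.K0_eq, hreps]
  exact M
end
end

section
/- Let n ≥ 1 and let K' = {g ∈ G : g₁₁, g₁₂ ∈ o_E, g₁₃ ∈ p_E^{1−n}, g₂₁ ∈ p_E^n, g₂₂ ∈ 1+p_E^n, g₂₃ ∈ o_E, g₃₁, g₃₂ ∈ p_E^n, g₃₃ ∈ o_E}. Then the q+1 elements t_n and u(0, x√ε), where x runs over a set of representatives of p_F^{−n}/p_F^{1−n}, form a complete set of representatives for the left coset space K_n / K'. -/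
set_option autoImplicit false

open MeasureTheory Matrix

noncomputable section

theorem GUset_mul {E : Type} [Field E] (s : E →+* E) {A B : Matrix (Fin 3) (Fin 3) E}
    (hA : A ∈ GUset s) (hB : B ∈ GUset s) : A * B ∈ GUset s := by
  simp only [GUset, Set.mem_ofPred_eq] at *
  rw [Matrix.map_mul, Matrix.transpose_mul]
  calc _ = (B.map s)ᵀ * ((A.map s)ᵀ * J3mat E * A) * B := by simp only [Matrix.mul_assoc]
    _ = _ := by rw [hA, hB]

theorem uM_mem {E : Type} [Field E] (s : E →+* E) (y : E) (hy : s y = -y) :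
    uM s 0 y ∈ GUset s := by
  simp only [GUset, Set.mem_ofPred_eq, J3mat, uM]
  ext i j
  fin_cases i <;> fin_cases j <;>
    simp [Matrix.mul_apply, Fin.sum_univ_three, hy]

theorem tU_mem {E : Type} [Field E] (s : E →+* E) (p : E) (hp : s p = p) (h0 : p ≠ 0) (n : ℤ) :
    tUmat p n ∈ GUset s := by
  simp only [GUset, Set.mem_ofPred_eq, J3mat, tUmat]
  ext i j
  fin_cases i <;> fin_cases j <;>
    simp [Matrix.mul_apply, Fin.sum_univ_three, hp, map_zpow₀, mul_inv_cancel₀ (zpow_ne_zero n h0), inv_mul_cancel₀ (zpow_ne_zero n h0)]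

theorem tU_sq {E : Type} [Field E] (p : E) (h0 : p ≠ 0) (n : ℤ) :
    tUmat p n * tUmat p n = 1 := by
  simp only [tUmat]
  ext i j
  fin_cases i <;> fin_cases j <;>
    simp [Matrix.mul_apply, Fin.sum_univ_three, mul_inv_cancel₀ (zpow_ne_zero n h0),
      inv_mul_cancel₀ (zpow_ne_zero n h0)]

theorem uM_mul {E : Type} [Field E] (s : E →+* E) (y z : E) :
    uM s 0 y * uM s 0 z = uM s 0 (y + z) := by
  simp only [uM]
  ext i j
  fin_cases i <;> fin_cases j <;>
    simp [Matrix.mul_apply, Fin.sum_univ_three, add_comm]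

theorem uM_zero {E : Type} [Field E] (s : E →+* E) : uM s 0 0 = 1 := by
  simp only [uM]
  ext i j
  fin_cases i <;> fin_cases j <;> simp

theorem GU_col {E : Type} [Field E] (s : E →+* E) {g : Matrix (Fin 3) (Fin 3) E}
    (hg : g ∈ GUset s) :
    s (g 2 2) * g 0 2 + s (g 1 2) * g 1 2 + s (g 0 2) * g 2 2 = 0 := by
  have h := congrFun (congrFun (show _ = _ from hg) 2) 2
  simpa [Matrix.mul_apply, Fin.sum_univ_three, J3mat] using h

/-- The `q+1` elements `t_n` and `u(0, x√ε)` form a complete set of representatives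
for `K_n / K'`. -/
theorem stmt_13
    (F : Type) [Field F] [CharZero F]
    (q : ℝ) (hq : 1 < q)
    (absF : F → ℝ)
    (habsF0 : ∀ x : F, absF x = 0 ↔ x = 0)
    (habsFmul : ∀ x y : F, absF (x * y) = absF x * absF y)
    (habsFadd : ∀ x y : F, absF (x + y) ≤ max (absF x) (absF y))
    (ϖ : F) (hϖ : absF ϖ = q⁻¹)
    (hvalF : ∀ x : F, x ≠ 0 → ∃ m : ℤ, absF x = q ^ m)
    (habsF2 : absF 2 = 1)
    (E : Type) [Field E] [Algebra F E]
    (σ : E → E)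
    (hσadd : ∀ x y : E, σ (x + y) = σ x + σ y)
    (hσmul : ∀ x y : E, σ (x * y) = σ x * σ y)
    (hσinvol : ∀ x : E, σ (σ x) = x)
    (hσfix : ∀ x : F, σ (algebraMap F E x) = algebraMap F E x)
    (ε : F) (sqrtε : E)
    (hεabs : absF ε = 1)
    (hεnonsq : ∀ a : F, a * a ≠ ε)
    (hsqrtε : sqrtε * sqrtε = algebraMap F E ε)
    (hσsqrtε : σ sqrtε = -sqrtε)
    (hspan : ∀ x : E, ∃ a b : F, x = algebraMap F E a + algebraMap F E b * sqrtε)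
    (absE : E → ℝ)
    (habsE0 : ∀ x : E, absE x = 0 ↔ x = 0)
    (habsEmul : ∀ x y : E, absE (x * y) = absE x * absE y)
    (habsEadd : ∀ x y : E, absE (x + y) ≤ max (absE x) (absE y))
    (habsEF : ∀ x : F, absE (algebraMap F E x) = absF x ^ 2)
    (habsEconj : ∀ x : E, absE (σ x) = absE x)
    (habsEspan : ∀ a b : F,
      absE (algebraMap F E a + algebraMap F E b * sqrtε) = max (absF a ^ 2) (absF b ^ 2))
    (hvalE : ∀ x : E, x ≠ 0 → ∃ m : ℤ, absE x = (q ^ 2) ^ m)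
    (n : ℤ) (hn : 1 ≤ n)
    (ι : Type) (xr : ι → F) (hxr : RepsF q absF (-n) (1 - n) xr)
    (reps : Option ι → Matrix (Fin 3) (Fin 3) E)
    (hreps : reps = fun o => o.elim (tUmat (algebraMap F E ϖ) n)
      (fun i => uM σ 0 (algebraMap F E (xr i) * sqrtε))) :
    IsCompleteReps (KUset q σ absE n)
      {g : Matrix (Fin 3) (Fin 3) E | g ∈ GUset σ ∧ absE (g 0 0) ≤ 1 ∧ absE (g 0 1) ≤ 1 ∧
        absE (g 0 2) ≤ (q ^ 2) ^ (n - 1) ∧ absE (g 1 0) ≤ (q ^ 2) ^ (-n) ∧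
        absE (g 1 1 - 1) ≤ (q ^ 2) ^ (-n) ∧ absE (g 1 2) ≤ 1 ∧
        absE (g 2 0) ≤ (q ^ 2) ^ (-n) ∧ absE (g 2 1) ≤ (q ^ 2) ^ (-n) ∧ absE (g 2 2) ≤ 1}
      reps := by
  have hq0 : (0:ℝ) < q := by linarith
  have hq1 : (1:ℝ) < q ^ 2 := by nlinarith
  have hqq : (0:ℝ) < q ^ 2 := by positivity
  have h1 : σ 1 = 1 := by simpa using hσfix 1
  have h0 : σ 0 = 0 := by simpa using hσfix 0
  let s : E →+* E :=
    { toFun := σ, map_one' := h1, map_mul' := hσmul, map_zero' := h0, map_add' := hσadd }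
  have hs : σ = s := rfl
  have aE0 : absE 0 = 0 := (habsE0 0).2 rfl
  have aE1 : absE 1 = 1 := by
    have := habsEmul 1 1
    rw [mul_one] at this
    have h' : absE 1 ≠ 0 := fun h => one_ne_zero ((habsE0 1).1 h)
    exact (mul_left_cancel₀ h' (by rw [mul_one]; exact this)).symm
  have aF0 : absF 0 = 0 := (habsF0 0).2 rfl
  have aFnn : ∀ x, 0 ≤ absF x := fun x => by
    by_cases hx : x = 0
    · rw [hx, aF0]
    · obtain ⟨m, hm⟩ := hvalF x hx
      rw [hm]; positivity
  have aEnn : ∀ x, 0 ≤ absE x := fun x => by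
    by_cases hx : x = 0
    · rw [hx, aE0]
    · obtain ⟨m, hm⟩ := hvalE x hx
      rw [hm]; positivity
  have aEneg : ∀ x, absE (-x) = absE x := fun x => by
    have h : absE (-1) * absE (-1) = 1 := by rw [← habsEmul]; simp [aE1]
    have h' : absE (-1) = 1 := by nlinarith [aEnn (-1)]
    rw [← neg_one_mul, habsEmul, h', one_mul]
  have hsqr : absE sqrtε = 1 := by
    have := habsEspan 0 1
    have h := habsEF 1
    simp only [map_one, aE1] at h
    simp only [map_zero, map_one, zero_add, one_mul, aF0, ← h] at this
    rw [this]; norm_num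
  have aEs : ∀ x : F, absE (algebraMap F E x * sqrtε) = absF x ^ 2 := fun x => by
    rw [habsEmul, hsqr, mul_one, habsEF]
  set p : E := algebraMap F E ϖ with hpdef
  have hpabs : absE p = (q ^ 2)⁻¹ := by rw [habsEF, hϖ, inv_pow]
  have hp0 : p ≠ 0 := by
    intro h
    rw [h, aE0] at hpabs
    exact (inv_pos.2 hqq).ne hpabs
  have hps : s p = p := hσfix ϖ
  have aEz : ∀ m : ℤ, absE (p ^ m) = (q ^ 2) ^ (-m) := by
    let a : E →*₀ ℝ := { toFun := absE, map_one' := aE1, map_mul' := habsEmul, map_zero' := aE0 }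
    intro m
    have : absE (p ^ m) = absE p ^ m := map_zpow₀ a p m
    rw [this, hpabs, _root_.inv_zpow, _root_.zpow_neg]
  have hys : ∀ x : F, s (algebraMap F E x * sqrtε) = -(algebraMap F E x * sqrtε) := fun x => by
    change σ _ = _
    rw [hσmul, hσfix, hσsqrtε, mul_neg]
  have sqz : ∀ (x : F) (m : ℤ), absF x ≤ q ^ m ↔ absF x ^ 2 ≤ (q ^ 2) ^ m := fun x m => by
    have : (q ^ 2) ^ m = (q ^ m) ^ 2 := by
      rw [← zpow_natCast, ← zpow_natCast, ← _root_.zpow_mul, ← _root_.zpow_mul, mul_comm]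
    rw [this]
    exact (pow_le_pow_iff_left₀ (aFnn x) (by positivity) two_ne_zero).symm
  have hnn : (1:ℝ) ≤ (q ^ 2) ^ (n - 1) := one_le_zpow₀ hq1.le (by omega)
  have hlt : (q ^ 2) ^ (n - 1) < (q ^ 2) ^ n := zpow_lt_zpow_right₀ hq1 (by omega)
  have hnpos : (0:ℝ) < (q ^ 2) ^ n := by positivity
  have hnneg : (0:ℝ) < (q ^ 2) ^ (-n) := by positivity
  have hprod : (q ^ 2) ^ n * (q ^ 2) ^ (-n) = 1 := by
    rw [← zpow_add₀ hqq.ne']; simp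
  have hprod1 : (q ^ 2) ^ n * (q ^ 2) ^ (-1 : ℤ) = (q ^ 2) ^ (n - 1) := by
    rw [← zpow_add₀ hqq.ne']; rfl
  obtain ⟨hx1, hx2, hx3⟩ := hxr
  rw [neg_neg] at hx1 hx3
  rw [neg_sub] at hx2 hx3
  subst hreps
  rw [hs]
  refine ⟨?_, ?_, ?_⟩
  · rintro (_ | i)
    · refine ⟨tU_mem s p hps hp0 n, ?_⟩
      simp [tUmat, aE0, aE1, aEz, -_root_.zpow_neg, hnneg.le]
    · refine ⟨uM_mem s _ (hys _), ?_⟩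
      simp [uM, aE0, aE1, aEs, -_root_.zpow_neg, hnneg.le]
      exact (sqz _ _).1 (hx1 i)
  · rintro (_ | i) (_ | j) ⟨c, ⟨hcG, -, -, hc, -⟩, hij⟩
    · rfl
    · exfalso
      have h := congrFun (congrFun hij 2) 2
      simp [tUmat, uM, Matrix.mul_apply, Fin.sum_univ_three] at h
      have h' := congrArg absE h
      rw [habsEmul, aEz, aE1] at h'
      have : (q ^ 2) ^ (-n) * absE (c 0 2) < (q ^ 2) ^ (-n) * (q ^ 2) ^ n :=
        mul_lt_mul_of_pos_left (hc.trans_lt hlt) hnneg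
      linarith
    · exfalso
      have h2 := congrFun (congrFun hij 2) 2
      have h := congrFun (congrFun hij 0) 2
      simp [tUmat, uM, Matrix.mul_apply, Fin.sum_univ_three, -_root_.zpow_neg] at h h2
      rw [h2, mul_zero, add_zero] at h
      rw [h, aEz, neg_neg] at hc
      linarith
    · congr 1
      have h2 := congrFun (congrFun hij 2) 2
      have h := congrFun (congrFun hij 0) 2
      simp [uM, Matrix.mul_apply, Fin.sum_univ_three] at h h2
      symm
      apply hx2
      rw [sqz, ← aEs, map_sub, sub_mul, ← h, h2, mul_one, add_sub_cancel_right]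
      exact hc
  · rintro g ⟨hG, g00, g01, g02, g10, g11, g12, g20, g21, g22⟩
    have hcol := GU_col s hG
    by_cases hu : absE (g 2 2) = 1
    · have hne : g 2 2 ≠ 0 := by
        intro h; rw [h, aE0] at hu; exact zero_ne_one hu
      obtain ⟨a, b, hab⟩ := hspan (g 0 2 / g 2 2)
      have hg02 : g 0 2 = (algebraMap F E a + algebraMap F E b * sqrtε) * g 2 2 := by
        rw [← hab, div_mul_cancel₀ _ hne]
      have hmax : max (absF a ^ 2) (absF b ^ 2) ≤ (q ^ 2) ^ n := by
        rw [← habsEspan]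
        rw [hg02, habsEmul, hu, mul_one] at g02
        exact g02
      have hb : absF b ≤ q ^ n := (sqz _ _).2 ((le_max_right _ _).trans hmax)
      have ha : absF a ^ 2 ≤ 1 := by
        have key : s (g 2 2) * g 2 2 * algebraMap F E (2 * a) = -(s (g 1 2) * g 1 2) := by
          have e1 : s (g 0 2) =
              (algebraMap F E a - algebraMap F E b * sqrtε) * s (g 2 2) := by
            rw [hg02, map_mul, map_add, hys, ← hs, hσfix, sub_eq_add_neg]
          rw [e1, hg02] at hcol
          rw [map_mul, map_ofNat]
          linear_combination hcol
        have h := congrArg absE key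
        rw [aEneg, habsEmul, habsEmul, habsEmul, ← hs, habsEconj, habsEconj, hu, habsEF,
          habsFmul, habsF2] at h
        simp only [one_mul] at h
        rw [h]
        exact mul_le_one₀ g12 (aEnn _) g12
      obtain ⟨i, hi⟩ := hx3 b hb
      refine ⟨some i, uM s 0 (-(algebraMap F E (xr i) * sqrtε)) * g, ⟨?_, ?_⟩, ?_⟩
      · refine GUset_mul s (uM_mem s _ ?_) hG
        rw [map_neg, hys]
      · have hyn : absE (algebraMap F E (xr i) * sqrtε) ≤ (q ^ 2) ^ n := by
          rw [aEs]; exact (sqz _ _).1 (hx1 i)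
        have hent : ∀ z w : E, absE z ≤ 1 → absE w ≤ (q ^ 2) ^ (-n) →
            absE (z + -(algebraMap F E (xr i) * sqrtε * w)) ≤ 1 := by
          intro z w hz hw
          refine (habsEadd _ _).trans (max_le hz ?_)
          rw [aEneg, habsEmul, ← hprod]
          exact mul_le_mul hyn hw (aEnn _) hnpos.le
        have hlast : absE (g 0 2 + -(algebraMap F E (xr i) * sqrtε * g 2 2))
            ≤ (q ^ 2) ^ (n - 1) := by
          have e : g 0 2 + -(algebraMap F E (xr i) * sqrtε * g 2 2) =
              (algebraMap F E a + algebraMap F E (b - xr i) * sqrtε) * g 2 2 := by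
            rw [hg02, map_sub]; ring
          rw [e, habsEmul, hu, mul_one, habsEspan]
          exact max_le (ha.trans hnn) ((sqz _ _).1 hi)
        simp [uM, Matrix.mul_apply, Fin.sum_univ_three, -_root_.zpow_neg]
        exact ⟨hent _ _ g00 g20, hent _ _ g01 g21, hlast, g10, g11, g12, g20, g21, g22⟩
      · change g = uM s 0 (algebraMap F E (xr i) * sqrtε) * _
        rw [← Matrix.mul_assoc, uM_mul, add_neg_cancel, uM_zero, Matrix.one_mul]
    · have hsm : absE (g 2 2) ≤ (q ^ 2) ^ (-1 : ℤ) := by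
        by_cases hz : g 2 2 = 0
        · rw [hz, aE0]; positivity
        · obtain ⟨m, hm⟩ := hvalE _ hz
          rw [hm] at hu g22 ⊢
          have hm0 : m ≤ 0 := by
            by_contra hc
            have := one_lt_zpow₀ hq1 (show 0 < m by omega)
            linarith
          have hm1 : m ≠ 0 := by rintro rfl; exact hu (zpow_zero _)
          exact zpow_le_zpow_right₀ hq1.le (by omega)
      have hA : ∀ w : E, absE w ≤ (q ^ 2) ^ (-n) → absE (p ^ (-n) * w) ≤ 1 := by
        intro w hw
        rw [habsEmul, aEz, neg_neg, ← hprod]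
        exact mul_le_mul_of_nonneg_left hw hnpos.le
      have hB : ∀ w : E, absE w ≤ 1 → absE (p ^ n * w) ≤ (q ^ 2) ^ (-n) := by
        intro w hw
        rw [habsEmul, aEz]
        exact mul_le_of_le_one_right hnneg.le hw
      refine ⟨none, tUmat p n * g, ⟨GUset_mul s (tU_mem s p hps hp0 n) hG, ?_⟩, ?_⟩
      · simp [tUmat, Matrix.mul_apply, Fin.sum_univ_three, -_root_.zpow_neg]
        refine ⟨hA _ g20, hA _ g21, ?_, g10, g11, g12, hB _ g00, hB _ g01, ?_⟩
        · rw [habsEmul, aEz, neg_neg, ← hprod1]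
          exact mul_le_mul_of_nonneg_left hsm hnpos.le
        · rw [habsEmul, aEz, ← hprod, mul_comm]
          exact mul_le_mul_of_nonneg_right g02 hnneg.le
      · change g = tUmat p n * _
        rw [← Matrix.mul_assoc, tU_sq p hp0, Matrix.one_mul]
end
end

section
/- Let n ≥ 1 and let K' = {g ∈ G : g₁₁, g₁₂ ∈ o_E, g₁₃ ∈ p_E^{1−n}, g₂₁ ∈ p_E^n, g₂₂ ∈ 1+p_E^n, g₂₃ ∈ o_E, g₃₁, g₃₂ ∈ p_E^n, g₃₃ ∈ o_E}. Then the q³ elements u(y, z√ε − yȳ/2), where y runs over a set of representatives of o_E/p_E and z over a set of representatives of p_F^{1−n}/p_F^{2−n}, form a complete set of representatives for the left coset space K' / (K_n ∩ ζ·K_n·ζ^{-1}). -/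
set_option autoImplicit false

open MeasureTheory Matrix

noncomputable section

theorem GU_mul {E : Type} [Field E] (s : E →+* E) (g h : Matrix (Fin 3) (Fin 3) E)
    (hg : g ∈ GUset s) (hh : h ∈ GUset s) : g * h ∈ GUset s := by
  simp only [GUset, Set.mem_ofPred_eq] at *
  rw [Matrix.map_mul, Matrix.transpose_mul]
  calc (h.map s)ᵀ * (g.map s)ᵀ * J3mat E * (g * h)
      = (h.map s)ᵀ * ((g.map s)ᵀ * J3mat E * g) * h := by simp only [Matrix.mul_assoc]
    _ = J3mat E := by rw [hg, hh]

theorem GU_entry {E : Type} [Field E] (s : E → E) (g : Matrix (Fin 3) (Fin 3) E)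
    (hg : g ∈ GUset s) (i j : Fin 3) :
    s (g 0 i) * g 2 j + s (g 1 i) * g 1 j + s (g 2 i) * g 0 j = J3mat E i j := by
  have h := congrFun (congrFun hg i) j
  rw [← h]
  simp [J3mat, Matrix.mul_apply, Fin.sum_univ_three]
  ring

theorem GU_u {E : Type} [Field E] (s : E →+* E) (hs : ∀ x, s (s x) = x) (x y : E)
    (h : y + s y + x * s x = 0) : uM s x y ∈ GUset s := by
  simp only [GUset, Set.mem_ofPred_eq, uM, J3mat]
  ext i j
  fin_cases i <;> fin_cases j <;>
    simp [Matrix.mul_apply, Fin.sum_univ_three, hs]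
  linear_combination h

theorem GU_diag {E : Type} [Field E] (s : E →+* E) (a b : E) (hsa : s a = a) (hsb : s b = b)
    (hab : a * b = 1) :
    (!![a, 0, 0; 0, 1, 0; 0, 0, b] : Matrix (Fin 3) (Fin 3) E) ∈ GUset s := by
  simp only [GUset, Set.mem_ofPred_eq, J3mat]
  ext i j
  fin_cases i <;> fin_cases j <;>
    simp [Matrix.mul_apply, Fin.sum_univ_three, hsa, hsb, hab]
  linear_combination hab

theorem u_mul_inv {E : Type} [Field E] (s : E →+* E) (x y : E)
    (h : y + s y + x * s x = 0) : uM s x y * uM s (-x) (s y) = 1 := by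
  simp only [uM]
  ext i j
  fin_cases i <;> fin_cases j <;>
    simp [Matrix.mul_apply, Fin.sum_univ_three]
  linear_combination h

theorem K0_entries {E : Type} [Field E] (p : E) (k : Matrix (Fin 3) (Fin 3) E) :
    (zUmat p * k * zUinv p) 0 2 = p * p * k 0 2 ∧ (zUmat p * k * zUinv p) 1 2 = p * k 1 2 := by
  constructor <;> simp [zUmat, zUinv, Matrix.mul_apply, Matrix.vecMul, dotProduct, Fin.sum_univ_three] <;> ring

theorem K0_conj {E : Type} [Field E] (p : E) (hp : p ≠ 0) (k : Matrix (Fin 3) (Fin 3) E) :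
    k = zUmat p * (zUinv p * k * zUmat p) * zUinv p := by
  have h1 : zUmat p * zUinv p = 1 := by
    ext i j
    fin_cases i <;> fin_cases j <;> simp [zUmat, zUinv, Matrix.mul_apply, Matrix.vecMul, dotProduct, Fin.sum_univ_three, hp]
  calc k = 1 * k * 1 := by simp
    _ = _ := by rw [← h1]; simp only [Matrix.mul_assoc]

/-- The `q³` elements `u(y, z√ε - yȳ/2)` form a complete set of representatives for
`K' / (K_n ∩ ζ K_n ζ⁻¹)`. -/
theorem stmt_14
    (F : Type) [Field F] [CharZero F]
    (q : ℝ) (hq : 1 < q)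
    (absF : F → ℝ)
    (habsF0 : ∀ x : F, absF x = 0 ↔ x = 0)
    (habsFmul : ∀ x y : F, absF (x * y) = absF x * absF y)
    (habsFadd : ∀ x y : F, absF (x + y) ≤ max (absF x) (absF y))
    (ϖ : F) (hϖ : absF ϖ = q⁻¹)
    (hvalF : ∀ x : F, x ≠ 0 → ∃ m : ℤ, absF x = q ^ m)
    (habsF2 : absF 2 = 1)
    (E : Type) [Field E] [Algebra F E]
    (σ : E → E)
    (hσadd : ∀ x y : E, σ (x + y) = σ x + σ y)
    (hσmul : ∀ x y : E, σ (x * y) = σ x * σ y)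
    (hσinvol : ∀ x : E, σ (σ x) = x)
    (hσfix : ∀ x : F, σ (algebraMap F E x) = algebraMap F E x)
    (ε : F) (sqrtε : E)
    (hεabs : absF ε = 1)
    (hεnonsq : ∀ a : F, a * a ≠ ε)
    (hsqrtε : sqrtε * sqrtε = algebraMap F E ε)
    (hσsqrtε : σ sqrtε = -sqrtε)
    (hspan : ∀ x : E, ∃ a b : F, x = algebraMap F E a + algebraMap F E b * sqrtε)
    (absE : E → ℝ)
    (habsE0 : ∀ x : E, absE x = 0 ↔ x = 0)
    (habsEmul : ∀ x y : E, absE (x * y) = absE x * absE y)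
    (habsEadd : ∀ x y : E, absE (x + y) ≤ max (absE x) (absE y))
    (habsEF : ∀ x : F, absE (algebraMap F E x) = absF x ^ 2)
    (habsEconj : ∀ x : E, absE (σ x) = absE x)
    (habsEspan : ∀ a b : F,
      absE (algebraMap F E a + algebraMap F E b * sqrtε) = max (absF a ^ 2) (absF b ^ 2))
    (hvalE : ∀ x : E, x ≠ 0 → ∃ m : ℤ, absE x = (q ^ 2) ^ m)
    (n : ℤ) (hn : 1 ≤ n)
    (ι₁ ι₂ : Type)
    (yr : ι₁ → E) (hyr : RepsE q absE 0 1 yr)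
    (zr : ι₂ → F) (hzr : RepsF q absF (1 - n) (2 - n) zr)
    (reps : ι₁ × ι₂ → Matrix (Fin 3) (Fin 3) E)
    (hreps : reps = fun p => uM σ (yr p.1)
      (algebraMap F E (zr p.2) * sqrtε - yr p.1 * σ (yr p.1) / 2)) :
    IsCompleteReps
      ({g : Matrix (Fin 3) (Fin 3) E | g ∈ GUset σ ∧ absE (g 0 0) ≤ 1 ∧ absE (g 0 1) ≤ 1 ∧
        absE (g 0 2) ≤ (q ^ 2) ^ (n - 1) ∧ absE (g 1 0) ≤ (q ^ 2) ^ (-n) ∧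
        absE (g 1 1 - 1) ≤ (q ^ 2) ^ (-n) ∧ absE (g 1 2) ≤ 1 ∧
        absE (g 2 0) ≤ (q ^ 2) ^ (-n) ∧ absE (g 2 1) ≤ (q ^ 2) ^ (-n) ∧ absE (g 2 2) ≤ 1})
      (KUset q σ absE n ∩
        {m | ∃ k ∈ KUset q σ absE n,
          m = zUmat (algebraMap F E ϖ) * k * zUinv (algebraMap F E ϖ)})
      reps := by
  subst hreps
  have hQ : (1:ℝ) < q ^ 2 := by nlinarith
  have hQ0 : (0:ℝ) < q ^ 2 := by linarith
  have h2F : (2:F) ≠ 0 := two_ne_zero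
  have hsone : σ 1 = 1 := by simpa using hσfix 1
  have hszero : σ 0 = 0 := by simpa using hσfix 0
  obtain ⟨s, hs⟩ : ∃ s : E →+* E, σ = s :=
    ⟨{ toFun := σ, map_one' := hsone, map_zero' := hszero, map_mul' := hσmul,
       map_add' := hσadd }, rfl⟩
  subst hs
  have h2E : (2:E) = algebraMap F E 2 := (map_ofNat (algebraMap F E) 2).symm
  have h2E0 : (2:E) ≠ 0 := by rw [h2E]; exact (map_ne_zero (algebraMap F E)).2 h2F
  have abs2 : absE 2 = 1 := by rw [h2E, habsEF, habsF2]; norm_num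
  have hnn : ∀ x, 0 ≤ absE x := by
    intro x
    by_cases hx : x = 0
    · rw [(habsE0 x).2 hx]
    · obtain ⟨m, hm⟩ := hvalE x hx
      rw [hm]; positivity
  have hnnF : ∀ x, 0 ≤ absF x := by
    intro x
    by_cases hx : x = 0
    · rw [(habsF0 x).2 hx]
    · obtain ⟨m, hm⟩ := hvalF x hx
      rw [hm]; positivity
  have abs1 : absE 1 = 1 := by
    have := habsEF 1
    have h1 := habsEmul 1 1
    have h3 : absE 1 ≠ 0 := fun h => one_ne_zero ((habsE0 1).1 h)
    rw [one_mul] at h1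
    exact (mul_left_cancel₀ h3 (by rw [mul_one]; exact h1)).symm
  have absneg1 : absE (-1) = 1 := by
    have h1 := habsEmul (-1) (-1)
    rw [neg_one_mul, neg_neg, abs1] at h1
    nlinarith [hnn (-1)]
  have hneg : ∀ x, absE (-x) = absE x := by
    intro x
    rw [← neg_one_mul, habsEmul, absneg1, one_mul]
  have habs0 : absE 0 = 0 := (habsE0 0).2 rfl
  obtain ⟨P, hP⟩ : ∃ P : ℤ → E → Prop, ∀ m x, P m x ↔ absE x ≤ (q^2)^m := ⟨_, fun _ _ => Iff.rfl⟩
  have P0 : ∀ x, P 0 x ↔ absE x ≤ 1 := by intro x; rw [hP]; simp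
  have Pmono : ∀ {a b : ℤ} {x : E}, P a x → a ≤ b → P b x := by
    intro a b x h hab
    rw [hP] at *
    exact h.trans (zpow_le_zpow_right₀ hQ.le hab)
  have Padd : ∀ {a : ℤ} {x y : E}, P a x → P a y → P a (x + y) := by
    intro a x y hx hy
    rw [hP] at *
    exact (habsEadd x y).trans (max_le hx hy)
  have Pneg : ∀ {a : ℤ} {x : E}, P a x → P a (-x) := by
    intro a x hx
    rw [hP] at *
    rwa [hneg]
  have Psub : ∀ {a : ℤ} {x y : E}, P a x → P a y → P a (x - y) := by
    intro a x y hx hy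
    rw [sub_eq_add_neg]
    exact Padd hx (Pneg hy)
  have Pmul : ∀ {a b : ℤ} (c : ℤ) {x y : E}, P a x → P b y → a + b ≤ c → P c (x * y) := by
    intro a b c x y hx hy hc
    refine Pmono ?_ hc
    rw [hP] at *
    rw [habsEmul, zpow_add₀ hQ0.ne']
    exact mul_le_mul hx hy (hnn _) (by positivity)
  have Ps : ∀ {a : ℤ} {x : E}, P a x → P a (s x) := by
    intro a x hx
    rw [hP] at *
    rwa [habsEconj]
  have Phalf : ∀ {a : ℤ} {x : E}, P a x → P a (x / 2) := by
    intro a x hx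
    rw [hP] at *
    have : absE (x / 2) * absE 2 = absE x := by rw [← habsEmul, div_mul_cancel₀ _ h2E0]
    rw [abs2, mul_one] at this
    rwa [this]
  have Pone : P 0 (1:E) := by rw [P0, abs1]
  have Pzero : ∀ a, P a (0:E) := by intro a; rw [hP, habs0]; positivity
  have PF : ∀ {a : ℤ} {b : F}, P a (algebraMap F E b * sqrtε) ↔ absF b ≤ q ^ a := by
    intro a b
    have h := habsEspan 0 b
    rw [map_zero, zero_add, (habsF0 0).2 rfl] at h
    rw [hP, h, max_eq_right (by simpa using sq_nonneg (absF b)), ← zpow_natCast q 2, ← _root_.zpow_mul, mul_comm, _root_.zpow_mul, zpow_natCast]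
    exact pow_le_pow_iff_left₀ (hnnF _) (by positivity) two_ne_zero
  -- unit quotient
  have Pdiv : ∀ {a : ℤ} {x y : E}, absE y = 1 → P a x → P a (x / y) := by
    intro a x y hy hx
    have hy0 : y ≠ 0 := by
      rintro rfl
      rw [habs0] at hy; norm_num at hy
    rw [hP] at *
    have : absE (x / y) * absE y = absE x := by rw [← habsEmul, div_mul_cancel₀ _ hy0]
    rw [hy, mul_one] at this
    rwa [this]
  set p : E := algebraMap F E ϖ with hpdef
  have habsp : absE p = (q^2)^(-1:ℤ) := by
    rw [hpdef, habsEF, hϖ]; simp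
  have hp0 : p ≠ 0 := by
    intro h
    rw [h, habs0] at habsp
    have : (0:ℝ) < (q^2)^(-1:ℤ) := by positivity
    linarith
  have Pp : P (-1) p := by rw [hP, habsp]
  have Ppi : P 1 p⁻¹ := by
    have h := habsEmul p p⁻¹
    rw [mul_inv_cancel₀ hp0, abs1, habsp] at h
    rw [hP]
    have h3 : (q^2)^(-1:ℤ) * absE p⁻¹ = (q^2)^(-1:ℤ) * (q^2)^(1:ℤ) := by
      rw [← h, ← zpow_add₀ hQ0.ne']; simp
    exact (mul_left_cancel₀ (by positivity) h3).le
  have hsp : s p = p := hσfix ϖ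
  have hspi : s p⁻¹ = p⁻¹ := by rw [map_inv₀, hsp]
  obtain ⟨hy1, hy2, hy3⟩ := hyr
  obtain ⟨hz1, hz2, hz3⟩ := hzr
  have s2 : s 2 = 2 := by rw [h2E]; exact hσfix 2
  -- trace relation
  have hw : ∀ (y : E) (z : F), (algebraMap F E z * sqrtε - y * s y / 2) +
      s (algebraMap F E z * sqrtε - y * s y / 2) + y * s y = 0 := by
    intro y z
    simp only [map_sub, map_mul, map_div₀, hσfix, hσsqrtε, hσinvol, s2]
    field_simp
    ring
  have yP : ∀ i, P 0 (yr i) := by intro i; rw [hP]; simpa using hy1 i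
  have wP : ∀ (y : E) (z : F), P 0 y → absF z ≤ q ^ (n-1) →
      P (n-1) (algebraMap F E z * sqrtε - y * s y / 2) := by
    intro y z hy hz
    exact Psub (PF.2 hz) (Pmono (Phalf (Pmul 0 hy (Ps hy) (by simp))) (by linarith))
  have zP : ∀ i, absF (zr i) ≤ q ^ (n-1) := by
    intro i; have := hz1 i; rwa [neg_sub] at this
  simp only [KUset, ← hP, ← P0]
  refine ⟨?_, ?_, ?_⟩
  · rintro ⟨i, j⟩
    have hi := yP i
    have hww := wP (yr i) (zr j) hi (zP j)
    refine ⟨GU_u s hσinvol _ _ (hw _ _), ?_⟩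
    refine ⟨?_, ?_, ?_, ?_, ?_, ?_, ?_, ?_, ?_⟩ <;> simp only [uM]
    · simpa using Pone
    · simpa using hi
    · simpa using hww
    · simpa using Pzero _
    · simpa using Pzero _
    · simpa using Pneg (Ps hi)
    · simpa using Pzero _
    · simpa using Pzero _
    · simpa using Pone
  · rintro ⟨i, j⟩ ⟨i', j'⟩ ⟨c, ⟨-, k, hk, hck⟩, hc⟩
    obtain ⟨-, -, -, k02, -, -, k12, -, -, -⟩ := hk
    obtain ⟨e02, e12⟩ := K0_entries p k
    rw [← hck] at e02 e12
    have c02 : P (n-2) (c 0 2) := by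
      rw [e02]; exact Pmul _ (Pmul (-2) Pp Pp (by norm_num)) k02 (by linarith)
    have c12 : P (-1) (c 1 2) := by
      rw [e12]; exact Pmul _ Pp k12 (by norm_num)
    have r2 : c 2 2 = 1 := by
      have := congrFun (congrFun hc 2) 2
      simpa [uM, Matrix.mul_apply, Fin.sum_univ_three] using this
    have r1 : c 1 2 - s (yr i) = - s (yr i') := by
      have := congrFun (congrFun hc 1) 2
      simpa [uM, Matrix.mul_apply, Fin.sum_univ_three, r2, ← sub_eq_add_neg] using this
    have r0 := congrFun (congrFun hc 0) 2
    simp [uM, Matrix.mul_apply, Fin.sum_univ_three, r2] at r0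
    have hii : i = i' := by
      apply hy2
      rw [← hP]
      have : yr i - yr i' = s (c 1 2) := by
        have h : c 1 2 = s (yr i - yr i') := by rw [map_sub]; linear_combination r1
        rw [h, hσinvol]
      rw [this]; exact Ps c12
    subst hii
    have c120 : c 1 2 = 0 := by linear_combination r1
    rw [c120] at r0
    have hjj : j' = j := by
      apply hz2
      rw [neg_sub]
      apply PF.1
      have : algebraMap F E (zr j' - zr j) * sqrtε = c 0 2 := by
        rw [map_sub]; linear_combination -r0
      rw [this]; exact c02
    rw [hjj]
  · rintro g ⟨hg, g00, g01, g02, g10, g11, g12, g20, g21, g22⟩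
    -- g22 is a unit
    have lt1 : ∀ {x}, P (-1) x → absE x < 1 := by
      intro x hx
      rw [hP] at hx
      refine hx.trans_lt ?_
      rw [_root_.zpow_neg_one]; exact inv_lt_one_of_one_lt₀ hQ
    have g22u : absE (g 2 2) = 1 := by
      have h := GU_entry s g hg 0 2
      simp [J3mat] at h
      have h1 : P (-1) (s (g 1 0) * g 1 2 + s (g 2 0) * g 0 2) :=
        Padd (Pmul _ (Ps g10) g12 (by linarith)) (Pmul _ (Ps g20) g02 (by linarith))
      have h2 := lt1 h1
      have h3 := habsEadd (s (g 0 0) * g 2 2) (s (g 1 0) * g 1 2 + s (g 2 0) * g 0 2)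
      rw [← add_assoc, h, abs1, habsEmul, habsEconj] at h3
      rw [P0] at g00 g22
      have h4 : 1 ≤ absE (g 0 0) * absE (g 2 2) := by
        rcases le_max_iff.1 h3 with h | h
        · exact h
        · linarith
      have : absE (g 0 0) * absE (g 2 2) ≤ absE (g 2 2) := mul_le_of_le_one_left (hnn _) g00
      linarith
    have g220 : g 2 2 ≠ 0 := by
      intro h; rw [h, habs0] at g22u; norm_num at g22u
    obtain ⟨i, hi⟩ := hy3 (s (-(g 1 2 / g 2 2))) (by
      have := Ps (Pneg (Pdiv g22u g12)); rw [hP] at this; simpa using this)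
    rw [← hP] at hi
    have yi := yP i
    set y := yr i with hydef
    have hc12 : P (-1) (g 1 2 + s y * g 2 2) := by
      have h : g 1 2 + s y * g 2 2 = - (s (s (-(g 1 2 / g 2 2)) - y) * g 2 2) := by
        rw [map_sub, hσinvol]; field_simp; ring
      rw [h]
      exact Pneg (Pmul _ (Ps hi) g22 (by norm_num))
    -- the intermediate matrix
    have hcG : ∀ z : F, uM s (-y) (s (algebraMap F E z * sqrtε - y * s y / 2)) * g ∈ GUset s := by
      intro z
      refine GU_mul s _ _ (GU_u s hσinvol _ _ ?_) hg
      have := hw y z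
      rw [hσinvol, map_neg]
      linear_combination this
    have sw : ∀ z : F, s (algebraMap F E z * sqrtε - y * s y / 2) =
        - (algebraMap F E z * sqrtε) - y * s y / 2 := by
      intro z
      linear_combination hw y z + div_mul_cancel₀ (y * s y) h2E0
    have hd := GU_entry s _ (hcG 0) 2 2
    obtain ⟨t, ht⟩ : ∃ t, t = (g 0 2 - y * g 1 2 - y * s y / 2 * g 2 2) / g 2 2 := ⟨_, rfl⟩
    have tg : t * g 2 2 = g 0 2 - y * g 1 2 - y * s y / 2 * g 2 2 := by
      rw [ht, div_mul_cancel₀ _ g220]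
    have tP : P (n-1) t := by
      rw [ht]
      refine Pdiv g22u (Psub (Psub g02 (Pmul _ yi g12 (by linarith))) ?_)
      exact Pmul _ (Phalf (Pmul 0 yi (Ps yi) (by simp))) g22 (by linarith)
    obtain ⟨a, b, hab⟩ := hspan t
    have e1 : (uM s (-y) (s (algebraMap F E 0 * sqrtε - y * s y / 2)) * g) 0 2 = t * g 2 2 := by
      rw [sw, tg]
      simp [uM, Matrix.mul_apply, Fin.sum_univ_three]
      ring
    have e2 : (uM s (-y) (s (algebraMap F E 0 * sqrtε - y * s y / 2)) * g) 1 2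
        = g 1 2 + s y * g 2 2 := by
      simp [uM, Matrix.mul_apply, Fin.sum_univ_three]
    have e3 : (uM s (-y) (s (algebraMap F E 0 * sqrtε - y * s y / 2)) * g) 2 2 = g 2 2 := by
      simp [uM, Matrix.mul_apply, Fin.sum_univ_three]
    rw [e1, e2, e3] at hd
    simp only [J3mat] at hd
    have aP : P (-1) (algebraMap F E a) := by
      have h : algebraMap F E a = - (s (g 1 2 + s y * g 2 2) * (g 1 2 + s y * g 2 2)
          / (s (g 2 2)) / (g 2 2)) / 2 := by
        have sg0 : s (g 2 2) ≠ 0 := by simpa using g220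
        have hst : s t = algebraMap F E a - algebraMap F E b * sqrtε := by
          rw [hab, map_add, map_mul, hσfix, hσfix, hσsqrtε]; ring
        rw [map_mul, hst, hab] at hd
        field_simp
        simp at hd
        simp
        linear_combination hd
      rw [h]
      exact Phalf (Pneg (Pdiv g22u (Pdiv (by rw [habsEconj, g22u])
        (Pmul _ (Ps hc12) hc12 (by norm_num)))))
    have bP : P (n-1) (algebraMap F E b * sqrtε) := by
      have : algebraMap F E b * sqrtε = t - algebraMap F E a := by rw [hab]; ring
      rw [this]; exact Psub tP (Pmono aP (by linarith))
    obtain ⟨j, hj⟩ := hz3 b (by rw [neg_sub]; exact PF.1 bP)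
    rw [neg_sub, ← PF] at hj
    set z := zr j with hzdef
    have wPz := wP y z yi (zP j)
    have hCG := hcG z
    set w := algebraMap F E z * sqrtε - y * s y / 2 with hwdef
    obtain ⟨c, hc⟩ : ∃ c, c = uM s (-y) (s w) * g := ⟨_, rfl⟩
    rw [← hc] at hCG
    have swP := Ps wPz
    have E0 : ∀ l, c 0 l = g 0 l - y * g 1 l + s w * g 2 l := by
      intro l; rw [hc]; simp [uM, Matrix.mul_apply, Fin.sum_univ_three]; ring
    have E1 : ∀ l, c 1 l = g 1 l + s y * g 2 l := by
      intro l; rw [hc]; fin_cases l <;> simp [uM, Matrix.mul_apply, Fin.sum_univ_three]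
    have E2 : ∀ l, c 2 l = g 2 l := by
      intro l; rw [hc]; fin_cases l <;> simp [uM, Matrix.mul_apply, Fin.sum_univ_three]
    have c20 : P (-n) (c 2 0) := by rw [E2]; exact g20
    have c21 : P (-n) (c 2 1) := by rw [E2]; exact g21
    have c22 : P 0 (c 2 2) := by rw [E2]; exact g22
    have c10 : P (-n) (c 1 0) := by
      rw [E1]; exact Padd g10 (Pmul _ (Ps yi) g20 (by linarith))
    have c11 : P (-n) (c 1 1 - 1) := by
      rw [E1, add_sub_right_comm]; exact Padd g11 (Pmul _ (Ps yi) g21 (by linarith))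
    have c11' : P 0 (c 1 1) := by
      have := Padd (Pmono c11 (by linarith)) Pone
      rwa [sub_add_cancel] at this
    have c12 : P (-1) (c 1 2) := by rw [E1]; exact hc12
    have c00 : P 0 (c 0 0) := by
      rw [E0]
      exact Padd (Psub g00 (Pmul _ yi g10 (by linarith))) (Pmul _ swP g20 (by linarith))
    have c02 : P (n-2) (c 0 2) := by
      have h : c 0 2 = (algebraMap F E a + algebraMap F E (b - z) * sqrtε) * g 2 2 := by
        rw [E0, sw z, map_sub]
        rw [hab] at tg
        linear_combination -tg
      rw [h]
      exact Pmul _ (Padd (Pmono aP (by linarith)) hj) g22 (by linarith)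
    have c01 : P (-1) (c 0 1) := by
      have h := GU_entry s c hCG 1 2
      simp [J3mat] at h
      have h2 : s (c 0 1) = -((s (c 1 1) * c 1 2 + s (c 2 1) * c 0 2) / c 2 2) := by
        have : c 2 2 ≠ 0 := by rw [E2]; exact g220
        field_simp
        linear_combination h
      have h3 : P (-1) (s (c 0 1)) := by
        rw [h2]
        refine Pneg (Pdiv (by rw [E2]; exact g22u) (Padd ?_ ?_))
        · exact Pmul _ (Ps c11') c12 (by linarith)
        · exact Pmul _ (Ps c21) c02 (by linarith)
      have := Ps h3
      rwa [hσinvol] at this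
    refine ⟨(i, j), c, ⟨⟨hCG, c00, Pmono c01 (by norm_num), Pmono c02 (by linarith), c10, c11,
      Pmono c12 (by norm_num), c20, c21, c22⟩, zUinv p * c * zUmat p, ?_, K0_conj p hp0 c⟩, ?_⟩
    · have m1 : zUmat p ∈ GUset s := GU_diag s _ _ hsp hspi (mul_inv_cancel₀ hp0)
      have m2 : zUinv p ∈ GUset s := GU_diag s _ _ hspi hsp (inv_mul_cancel₀ hp0)
      refine ⟨GU_mul s _ _ (GU_mul s _ _ m2 hCG) m1, ?_⟩
      have f00 : (zUinv p * c * zUmat p) 0 0 = c 0 0 := by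
        simp [zUmat, zUinv, Matrix.mul_apply, Matrix.vecMul, dotProduct, Fin.sum_univ_three]; field_simp
      have f01 : (zUinv p * c * zUmat p) 0 1 = p⁻¹ * c 0 1 := by
        simp [zUmat, zUinv, Matrix.mul_apply, Matrix.vecMul, dotProduct, Fin.sum_univ_three]
      have f02 : (zUinv p * c * zUmat p) 0 2 = p⁻¹ * p⁻¹ * c 0 2 := by
        simp [zUmat, zUinv, Matrix.mul_apply, Matrix.vecMul, dotProduct, Fin.sum_univ_three]; ring
      have f10 : (zUinv p * c * zUmat p) 1 0 = p * c 1 0 := by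
        simp [zUmat, zUinv, Matrix.mul_apply, Matrix.vecMul, dotProduct, Fin.sum_univ_three]; ring
      have f11 : (zUinv p * c * zUmat p) 1 1 = c 1 1 := by
        simp [zUmat, zUinv, Matrix.mul_apply, Matrix.vecMul, dotProduct, Fin.sum_univ_three]
      have f12 : (zUinv p * c * zUmat p) 1 2 = p⁻¹ * c 1 2 := by
        simp [zUmat, zUinv, Matrix.mul_apply, Matrix.vecMul, dotProduct, Fin.sum_univ_three]; ring
      have f20 : (zUinv p * c * zUmat p) 2 0 = p * p * c 2 0 := by
        simp [zUmat, zUinv, Matrix.mul_apply, Matrix.vecMul, dotProduct, Fin.sum_univ_three]; ring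
      have f21 : (zUinv p * c * zUmat p) 2 1 = p * c 2 1 := by
        simp [zUmat, zUinv, Matrix.mul_apply, Matrix.vecMul, dotProduct, Fin.sum_univ_three]
      have f22 : (zUinv p * c * zUmat p) 2 2 = c 2 2 := by
        simp [zUmat, zUinv, Matrix.mul_apply, Matrix.vecMul, dotProduct, Fin.sum_univ_three]; field_simp
      rw [f00, f01, f02, f10, f11, f12, f20, f21, f22]
      exact ⟨c00, Pmul _ Ppi c01 (by norm_num),
        Pmul _ (Pmul 2 Ppi Ppi (by norm_num)) c02 (by linarith),
        Pmul _ Pp c10 (by linarith), c11, Pmul _ Ppi c12 (by norm_num),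
        Pmul _ (Pmul (-2) Pp Pp (by norm_num)) c20 (by linarith),
        Pmul _ Pp c21 (by linarith), c22⟩
    · show g = uM s y w * c
      rw [hc, ← Matrix.mul_assoc, u_mul_inv s y w (hw y z), Matrix.one_mul]
end
end

section
/- Let n ≥ 2. The elements t_{n−1}·û(y, −yȳ/2), where y runs over a set of representatives of p_E^{n−1}/p_E^n, together with the elements û(a, b√ε − aā/2), where a runs over p_E^{n−1}/p_E^n and b over p_F^{n−1}/p_F^n, form a complete set of representatives for the left coset space K_{n−1} / (K_{n−1} ∩ (Z_{n−1}·K_n)). -/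
set_option autoImplicit false

open MeasureTheory Matrix

noncomputable section

/-- A discrete non-archimedean absolute value together with an invariant involution. -/
structure VS {E : Type} [Field E] (q : ℝ) (σ : E →+* E) (v : E → ℝ) : Prop where
  hq : 1 < q
  zero : ∀ x : E, v x = 0 ↔ x = 0
  mul : ∀ x y : E, v (x * y) = v x * v y
  add : ∀ x y : E, v (x + y) ≤ max (v x) (v y)
  conj : ∀ x : E, v (σ x) = v x
  val : ∀ x : E, x ≠ 0 → ∃ m : ℤ, v x = (q ^ 2) ^ m
  two : v 2 = 1
  invol : ∀ x : E, σ (σ x) = x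

/-- `x` lies in `p_E^k`. -/
def Bd {E : Type} (q : ℝ) (v : E → ℝ) (k : ℤ) (x : E) : Prop := v x ≤ (q ^ 2) ^ (-k)

section
variable {E : Type} [Field E] {q : ℝ} {σ : E →+* E} {v : E → ℝ}

theorem VS.hQ (h : VS q σ v) : 1 < q ^ 2 := by nlinarith [h.hq]

theorem VS.nonneg (h : VS q σ v) (x : E) : 0 ≤ v x := by
  by_cases hx : x = 0
  · rw [(h.zero x).2 hx]
  · obtain ⟨m, hm⟩ := h.val x hx
    rw [hm]
    have := h.hQ
    positivity

theorem VS.one (h : VS q σ v) : v 1 = 1 := by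
  have h1 := h.mul 1 1
  have h0 : v 1 ≠ 0 := fun e => one_ne_zero ((h.zero 1).1 e)
  rw [mul_one] at h1
  have : v 1 * (v 1 - 1) = 0 := by linarith
  rcases mul_eq_zero.1 this with h2 | h2
  · exact absurd h2 h0
  · linarith

theorem VS.neg (h : VS q σ v) (x : E) : v (-x) = v x := by
  have h1 : v (-1) * v (-1) = 1 := by rw [← h.mul]; simp [h.one]
  have h2 := h.nonneg (-1)
  have h3 : v (-1) = 1 := by nlinarith
  have := h.mul (-1) x
  rw [h3] at this
  simpa using this

theorem VS.two_ne (h : VS q σ v) : (2 : E) ≠ 0 := by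
  intro e
  have := h.two
  rw [(h.zero 2).2 e] at this
  norm_num at this

theorem VS.bmono (h : VS q σ v) {a b : ℤ} {x : E} (hx : Bd q v a x) (hab : b ≤ a) : Bd q v b x :=
  le_trans hx (zpow_le_zpow_right₀ h.hQ.le (by omega))

theorem VS.badd (h : VS q σ v) {a : ℤ} {x y : E} (hx : Bd q v a x) (hy : Bd q v a y) :
    Bd q v a (x + y) := le_trans (h.add x y) (max_le hx hy)

theorem VS.bneg (h : VS q σ v) {a : ℤ} {x : E} (hx : Bd q v a x) : Bd q v a (-x) := by
  unfold Bd; rw [h.neg]; exact hx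

theorem VS.bsub (h : VS q σ v) {a : ℤ} {x y : E} (hx : Bd q v a x) (hy : Bd q v a y) :
    Bd q v a (x - y) := by rw [sub_eq_add_neg]; exact h.badd hx (h.bneg hy)

theorem VS.bconj (h : VS q σ v) {a : ℤ} {x : E} (hx : Bd q v a x) : Bd q v a (σ x) := by
  unfold Bd; rw [h.conj]; exact hx

theorem VS.bmul (h : VS q σ v) {a b c : ℤ} {x y : E} (hx : Bd q v a x) (hy : Bd q v b y)
    (hc : c ≤ a + b) : Bd q v c (x * y) := by
  refine h.bmono (a := a + b) ?_ hc
  unfold Bd at *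
  have := h.hQ
  rw [h.mul, neg_add, zpow_add₀ (by positivity)]
  exact mul_le_mul hx hy (h.nonneg _) (by positivity)

theorem VS.bzero (h : VS q σ v) (a : ℤ) : Bd q v a 0 := by
  unfold Bd; rw [(h.zero 0).2 rfl]; have := h.hQ; positivity

theorem VS.b0 {x : E} : Bd q v 0 x ↔ v x ≤ 1 := by simp [Bd]

theorem VS.bone (h : VS q σ v) {a : ℤ} (ha : a ≤ 0) : Bd q v a 1 :=
  h.bmono (VS.b0.2 h.one.le) ha

theorem VS.lt_one (h : VS q σ v) {x : E} (hx : v x < 1) : Bd q v 1 x := by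
  by_cases h0 : x = 0
  · rw [h0]; exact h.bzero 1
  · obtain ⟨m, hm⟩ := h.val x h0
    have hQ := h.hQ
    unfold Bd
    rw [hm] at hx ⊢
    have : (q ^ 2) ^ m < (q ^ 2) ^ (0 : ℤ) := by simpa using hx
    have := (zpow_lt_zpow_iff_right₀ hQ).1 this
    exact zpow_le_zpow_right₀ hQ.le (by omega)

theorem VS.not_unit (h : VS q σ v) {x : E} (hx : Bd q v 1 x) : v x < 1 := by
  have hQ := h.hQ
  refine lt_of_le_of_lt hx ?_
  rw [_root_.zpow_neg, _root_.zpow_one]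
  exact inv_lt_one_of_one_lt₀ hQ

/-- An element congruent to a unit is a unit. -/
theorem VS.unit (h : VS q σ v) {x y : E} (hx : v x = 1) (hy : Bd q v 1 (x - y)) : v y = 1 := by
  have h1 := h.not_unit hy
  have h2 : v y ≤ 1 := by
    have := h.add x (-(x - y))
    rw [h.neg, hx] at this
    have e : x + -(x - y) = y := by ring
    rw [e] at this
    exact this.trans (max_le le_rfl h1.le)
  by_contra h3
  have h4 : v y < 1 := lt_of_le_of_ne h2 h3
  have := h.add y (x - y)
  rw [add_sub_cancel, hx] at this
  exact absurd this (not_le.2 (max_lt h4 h1))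

theorem VS.bdiv (h : VS q σ v) {a : ℤ} {x y : E} (hx : Bd q v a x) (hy : v y = 1) :
    Bd q v a (x / y) := by
  have hy0 : y ≠ 0 := by
    intro e
    rw [(h.zero y).2 e] at hy
    norm_num at hy
  have : v (x / y) * v y = v x := by rw [← h.mul, div_mul_cancel₀ _ hy0]
  unfold Bd at *
  rw [hy, mul_one] at this
  rw [this]; exact hx

theorem VS.unit_ne (h : VS q σ v) {y : E} (hy : v y = 1) : y ≠ 0 := by
  intro e
  rw [(h.zero y).2 e] at hy
  norm_num at hy

/-- Entrywise form of the unitary relation. -/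
theorem gu_entry {g : Matrix (Fin 3) (Fin 3) E} (hg : g ∈ GUset σ) (i j : Fin 3) :
    σ (g 0 i) * g 2 j + σ (g 1 i) * g 1 j + σ (g 2 i) * g 0 j = J3mat E i j := by
  have := congrFun (congrFun hg i) j
  rw [← this]
  simp [Matrix.mul_apply, Fin.sum_univ_three, J3mat]
  ring

theorem gu_mul {g k : Matrix (Fin 3) (Fin 3) E} (hg : g ∈ GUset σ) (hk : k ∈ GUset σ) :
    g * k ∈ GUset σ := by
  unfold GUset at *
  simp only [Set.mem_ofPred_eq] at *
  rw [Matrix.map_mul, Matrix.transpose_mul]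
  calc _ = (k.map σ)ᵀ * ((g.map σ)ᵀ * J3mat E * g) * k := by simp only [Matrix.mul_assoc]
    _ = _ := by rw [hg, hk]

theorem ku_iff {n : ℤ} {g : Matrix (Fin 3) (Fin 3) E} : g ∈ KUset q σ v n ↔
    g ∈ GUset σ ∧ Bd q v 0 (g 0 0) ∧ Bd q v 0 (g 0 1) ∧ Bd q v (-n) (g 0 2) ∧
    Bd q v n (g 1 0) ∧ Bd q v n (g 1 1 - 1) ∧ Bd q v 0 (g 1 2) ∧
    Bd q v n (g 2 0) ∧ Bd q v n (g 2 1) ∧ Bd q v 0 (g 2 2) := by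
  unfold KUset Bd
  simp only [neg_neg, neg_zero, _root_.zpow_zero]
  rfl

theorem VS.b11 (h : VS q σ v) {n : ℤ} (hn : 0 ≤ n) {x : E} (hx : Bd q v n (x - 1)) :
    Bd q v 0 x := by
  have := h.badd (h.bmono hx hn) (h.bone le_rfl)
  simpa using this

theorem ku_mul (h : VS q σ v) {n : ℤ} (hn : 0 ≤ n) {g k : Matrix (Fin 3) (Fin 3) E}
    (hg : g ∈ KUset q σ v n) (hk : k ∈ KUset q σ v n) : g * k ∈ KUset q σ v n := by
  rw [ku_iff] at *
  obtain ⟨g0, g1, g2, g3, g4, g5, g6, g7, g8, g9⟩ := hg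
  obtain ⟨k0, k1, k2, k3, k4, k5, k6, k7, k8, k9⟩ := hk
  have g5' := h.b11 hn g5
  have k5' := h.b11 hn k5
  refine ⟨gu_mul g0 k0, ?_⟩
  simp only [Matrix.mul_apply, Fin.sum_univ_three]
  refine ⟨?_, ?_, ?_, ?_, ?_, ?_, ?_, ?_, ?_⟩
  · exact h.badd (h.badd (h.bmul g1 k1 (by omega)) (h.bmul g2 k4 (by omega)))
      (h.bmul g3 k7 (by omega))
  · exact h.badd (h.badd (h.bmul g1 k2 (by omega)) (h.bmul g2 k5' (by omega)))
      (h.bmul g3 k8 (by omega))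
  · exact h.badd (h.badd (h.bmul g1 k3 (by omega)) (h.bmul g2 k6 (by omega)))
      (h.bmul g3 k9 (by omega))
  · exact h.badd (h.badd (h.bmul g4 k1 (by omega)) (h.bmul g5' k4 (by omega)))
      (h.bmul g6 k7 (by omega))
  · have e : g 1 0 * k 0 1 + g 1 1 * k 1 1 + g 1 2 * k 2 1 - 1 =
        g 1 0 * k 0 1 + ((g 1 1 - 1) * k 1 1 + (k 1 1 - 1)) + g 1 2 * k 2 1 := by ring
    rw [e]
    exact h.badd (h.badd (h.bmul g4 k2 (by omega)) (h.badd (h.bmul g5 k5' (by omega)) k5))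
      (h.bmul g6 k8 (by omega))
  · exact h.badd (h.badd (h.bmul g4 k3 (by omega)) (h.bmul g5' k6 (by omega)))
      (h.bmul g6 k9 (by omega))
  · exact h.badd (h.badd (h.bmul g7 k1 (by omega)) (h.bmul g8 k4 (by omega)))
      (h.bmul g9 k7 (by omega))
  · exact h.badd (h.badd (h.bmul g7 k2 (by omega)) (h.bmul g8 k5' (by omega)))
      (h.bmul g9 k8 (by omega))
  · exact h.badd (h.badd (h.bmul g7 k3 (by omega)) (h.bmul g8 k6 (by omega)))
      (h.bmul g9 k9 (by omega))

theorem uhat_ku (h : VS q σ v) {m : ℤ} (hm : 0 ≤ m) {x y : E} (hxy : y + σ y + x * σ x = 0)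
    (hx : Bd q v m x) (hy : Bd q v m y) : uhatM σ x y ∈ KUset q σ v m := by
  rw [ku_iff]
  refine ⟨?_, ?_⟩
  · unfold GUset
    simp only [Set.mem_ofPred_eq]
    have := h.invol
    ext i j
    fin_cases i <;> fin_cases j <;>
      simp [uhatM, J3mat, Matrix.mul_apply, Fin.sum_univ_three, this]
    linear_combination hxy
  · simp [uhatM]
    exact ⟨h.bone le_rfl, h.bzero _, h.bzero _, hx, h.bzero _, h.bzero _, hy,
      h.bneg (h.bconj hx), h.bone le_rfl⟩

theorem t_ku (h : VS q σ v) {m : ℤ} {p : E} (hp : v p = (q ^ 2)⁻¹) (hσ : σ p = p) :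
    tUmat p m ∈ KUset q σ v m ∧ tUmat p m * tUmat p m = 1 ∧ Bd q v m (p ^ m) ∧
      Bd q v (-m) (p ^ (-m)) ∧ v (p ^ m) = (q ^ 2) ^ (-m) ∧ p ≠ 0 := by
  have hQ := h.hQ
  have hp0 : p ≠ 0 := by
    intro e
    rw [(h.zero p).2 e] at hp
    have : 0 < (q ^ 2)⁻¹ := by positivity
    linarith
  let V : E →*₀ ℝ := { toFun := v, map_zero' := (h.zero 0).2 rfl, map_one' := h.one, map_mul' := h.mul }
  have hz : ∀ k : ℤ, v (p ^ k) = (q ^ 2) ^ (-k) := by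
    intro k
    have := map_zpow₀ V p k
    change v (p ^ k) = (v p) ^ k at this
    rw [this, hp, _root_.inv_zpow, _root_.zpow_neg]
  have hpm : p ^ m ≠ 0 := zpow_ne_zero _ hp0
  have b1 : Bd q v m (p ^ m) := (hz m).le
  have b2 : Bd q v (-m) (p ^ (-m)) := (hz (-m)).le
  refine ⟨?_, ?_, b1, b2, hz m, hp0⟩
  · rw [ku_iff]
    refine ⟨?_, ?_⟩
    · unfold GUset
      simp only [Set.mem_ofPred_eq]
      ext i j
      fin_cases i <;> fin_cases j <;>
        simp [tUmat, J3mat, Matrix.mul_apply, Fin.sum_univ_three, hσ, hpm]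
    · have e : tUmat p m 1 1 - 1 = 0 := by simp [tUmat]
      rw [e]
      exact ⟨h.bzero _, h.bzero _, b2, h.bzero _, h.bzero _, h.bzero _, b1, h.bzero _, h.bzero _⟩
  · ext i j
    fin_cases i <;> fin_cases j <;>
        simp [tUmat, Matrix.mul_apply, Fin.sum_univ_three, hpm]

/-- Existence of a norm one element close to an element with norm close to one. -/
theorem exists_z (h : VS q σ v) {n : ℤ} (hn : 2 ≤ n) {w : E} (hw : Bd q v (n - 1) (w - 1))
    (hN : Bd q v n (w * σ w - 1)) :
    ∃ z : E, z * σ z = 1 ∧ Bd q v (n - 1) (z - 1) ∧ Bd q v n (w - z) := by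
  have h2 := h.two_ne
  obtain ⟨x, rfl⟩ : ∃ x, w = 1 + x := ⟨w - 1, by ring⟩
  have hx : Bd q v (n - 1) x := by simpa using hw
  have hσx := h.bconj hx
  have hT : Bd q v n (x + σ x) := by
    have e : x + σ x = ((1 + x) * σ (1 + x) - 1) - x * σ x := by simp; ring
    rw [e]
    exact h.bsub hN (h.bmul hx hσx (by omega))
  obtain ⟨d, hd⟩ : ∃ d, d = (x - σ x) / 2 / 2 := ⟨_, rfl⟩
  have bd : Bd q v (n - 1) d := by
    rw [hd]; exact h.bdiv (h.bdiv (h.bsub hx hσx) h.two) h.two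
  have b2 : Bd q v 0 (2 : E) := VS.b0.2 h.two.le
  have sd : σ d = -d := by
    rw [hd]; simp [h.invol, map_ofNat]; ring
  have u1 : v (1 - d) = 1 := h.unit h.one (by simpa using h.bmono bd (by omega))
  have u2 : v (1 + d) = 1 := h.unit h.one (by simpa using h.bneg (h.bmono bd (by omega)))
  have n1 := h.unit_ne u1
  have n2 := h.unit_ne u2
  refine ⟨(1 + d) / (1 - d), ?_, ?_, ?_⟩
  · simp [sd]
    rw [← sub_eq_add_neg]
    field_simp
  · have e : (1 + d) / (1 - d) - 1 = (2 * d) / (1 - d) := by field_simp; ring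
    rw [e]
    exact h.bdiv (h.bmul b2 bd (by omega)) u1
  · have e : 1 + x - (1 + d) / (1 - d) = ((x + σ x) / 2 - x * d) / (1 - d) := by
      have : σ x = x - 4 * d := by rw [hd]; field_simp; ring
      rw [this]
      field_simp; ring
    rw [e]
    exact h.bdiv (h.bsub (h.bdiv hT h.two) (h.bmul hx bd (by omega))) u1

/-- The subgroup `Z_{n-1} K_n`, as in the statement. -/
def ZK (q : ℝ) (σ : E → E) (v : E → ℝ) (n : ℤ) : Set (Matrix (Fin 3) (Fin 3) E) :=
  {m | ∃ c ∈ ZUset q σ v (n - 1), ∃ k ∈ KUset q σ v n, m = c * k}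

theorem mem_zk (h : VS q σ v) {n : ℤ} (hn : 2 ≤ n) {g : Matrix (Fin 3) (Fin 3) E}
    (hg : g ∈ KUset q σ v (n - 1)) (h10 : Bd q v n (g 1 0)) (h20 : Bd q v n (g 2 0))
    (h21 : Bd q v n (g 2 1)) : g ∈ ZK q σ v n := by
  rw [ku_iff] at hg
  obtain ⟨g0, g1, g2, g3, g4, g5, g6, g7, g8, g9⟩ := hg
  have r := gu_entry g0 1 1
  simp only [J3mat] at r
  simp at r
  obtain ⟨z, z1, z2, z3⟩ := exists_z h hn g5 (by
    have e : g 1 1 * σ (g 1 1) - 1 = -(σ (g 0 1) * g 2 1 + σ (g 2 1) * g 0 1) := by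
      linear_combination r
    rw [e]
    exact h.bneg (h.badd (h.bmul (h.bconj g2) h21 (by omega))
      (h.bmul (h.bconj h21) g2 (by omega))))
  have bz := h.bconj (h.b11 (by omega) z2)
  refine ⟨z • 1, ⟨z, z1, z2, rfl⟩, σ z • g, ?_, ?_⟩
  · rw [ku_iff]
    refine ⟨?_, ?_⟩
    · unfold GUset at *
      simp only [Set.mem_ofPred_eq] at *
      have e : ((σ z • g).map σ)ᵀ = z • (g.map σ)ᵀ := by
        ext i j; simp [h.invol]
      rw [e]
      simp only [Matrix.smul_mul, Matrix.mul_smul, g0, smul_smul]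
      rw [mul_comm, z1, one_smul]
    · simp only [Matrix.smul_apply, smul_eq_mul]
      have e : σ z * g 1 1 - 1 = σ z * (g 1 1 - z) := by linear_combination z1
      rw [e]
      exact ⟨h.bmul bz g1 (by omega), h.bmul bz g2 (by omega), h.bmul bz g3 (by omega),
        h.bmul bz h10 (by omega), h.bmul bz z3 (by omega), h.bmul bz g6 (by omega),
        h.bmul bz h20 (by omega), h.bmul bz h21 (by omega), h.bmul bz g9 (by omega)⟩
  · rw [Matrix.smul_mul, Matrix.one_mul, smul_smul, z1, one_smul]

theorem zk_mem (h : VS q σ v) {n : ℤ} (hn : 2 ≤ n) {g : Matrix (Fin 3) (Fin 3) E}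
    (hg : g ∈ KUset q σ v (n - 1)) (hz : g ∈ ZK q σ v n) :
    Bd q v n (g 1 0) ∧ Bd q v n (g 2 0) ∧ v (g 0 0) = 1 := by
  obtain ⟨c, ⟨z, z1, z2, rfl⟩, k, hk, rfl⟩ := hz
  rw [ku_iff] at hk hg
  obtain ⟨k0, k1, k2, k3, k4, k5, k6, k7, k8, k9⟩ := hk
  obtain ⟨g0, g1, g2, g3, g4, g5, g6, g7, g8, g9⟩ := hg
  have bz := h.b11 (n := n - 1) (by omega) z2
  have a1 : Bd q v n ((z • (1 : Matrix (Fin 3) (Fin 3) E) * k) 1 0) := by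
    simp; exact h.bmul bz k4 (by omega)
  have a2 : Bd q v n ((z • (1 : Matrix (Fin 3) (Fin 3) E) * k) 2 0) := by
    simp; exact h.bmul bz k7 (by omega)
  refine ⟨a1, a2, ?_⟩
  generalize (z • (1 : Matrix (Fin 3) (Fin 3) E) * k) = g at *
  have r := gu_entry g0 0 2
  simp only [J3mat] at r
  simp at r
  by_contra hne
  have lt : v (g 0 0) < 1 := lt_of_le_of_ne (VS.b0.1 g1) hne
  have b := h.lt_one lt
  have : Bd q v 1 (1 : E) := by
    rw [← r]
    exact h.badd (h.badd (h.bmul (h.bconj b) g9 (by omega)) (h.bmul (h.bconj a1) g6 (by omega)))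
      (h.bmul (h.bconj a2) g3 (by omega))
  have := h.not_unit this
  rw [h.one] at this
  exact lt_irrefl _ this

theorem uhat_inv {x y : E} (h : VS q σ v) (hxy : y + σ y + x * σ x = 0) :
    uhatM σ x y * uhatM σ (-x) (σ y) = 1 := by
  ext i j
  fin_cases i <;> fin_cases j <;>
    simp [uhatM, Matrix.mul_apply, Fin.sum_univ_three]
  linear_combination hxy

theorem inj_aux (h : VS q σ v) {n : ℤ} (hn : 2 ≤ n) {c : Matrix (Fin 3) (Fin 3) E}
    (hc : c ∈ KUset q σ v (n - 1) ∩ ZK q σ v n) {x y x' y' : E} (hx : Bd q v (n - 1) x)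
    (he : uhatM σ x y * c = uhatM σ x' y') : Bd q v n (x' - x) ∧ Bd q v n (y' - y) := by
  obtain ⟨c1, c2, c3⟩ := zk_mem h hn hc.1 hc.2
  have e0 := congrFun (congrFun he 0) 0
  have e1 := congrFun (congrFun he 1) 0
  have e2 := congrFun (congrFun he 2) 0
  simp [uhatM, Matrix.mul_apply, Fin.sum_univ_three] at e0 e1 e2
  rw [e0] at e1 e2
  constructor
  · have e : x' - x = c 1 0 := by linear_combination -e1
    rw [e]; exact c1
  · have e : y' - y = c 2 0 - σ x * c 1 0 := by linear_combination -e2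
    rw [e]; exact h.bsub c2 (h.bmul (h.bconj hx) c1 (by omega))

theorem ne_aux (h : VS q σ v) {n : ℤ} (hn : 2 ≤ n) {c : Matrix (Fin 3) (Fin 3) E}
    (hc : c ∈ KUset q σ v (n - 1) ∩ ZK q σ v n) {x y x' y' p : E} (hp : v p = (q ^ 2)⁻¹)
    (hσ : σ p = p) (hy' : Bd q v n y')
    (he : uhatM σ x y * c = tUmat p (n - 1) * uhatM σ x' y') : False := by
  obtain ⟨c1, c2, c3⟩ := zk_mem h hn hc.1 hc.2
  obtain ⟨-, -, t1, t2, t3, -⟩ := t_ku (m := n - 1) h hp hσ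
  have e0 := congrFun (congrFun he 0) 0
  simp only [uhatM, tUmat, Matrix.mul_apply, Fin.sum_univ_three] at e0
  simp at e0
  rw [← neg_sub n 1] at e0
  have : Bd q v 1 (c 0 0) := by
    rw [e0]; exact h.bmul t2 hy' (by omega)
  have := h.not_unit this
  rw [c3] at this
  exact lt_irrefl _ this

theorem ne_aux2 (h : VS q σ v) {n : ℤ} (hn : 2 ≤ n) {c : Matrix (Fin 3) (Fin 3) E}
    (hc : c ∈ KUset q σ v (n - 1) ∩ ZK q σ v n) {x y x' y' p : E} (hp : v p = (q ^ 2)⁻¹)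
    (hσ : σ p = p) (hx : Bd q v (n - 1) x) (hy : Bd q v n y)
    (he : uhatM σ x y * c = tUmat p (n - 1) * uhatM σ x' y') : False := by
  obtain ⟨c1, c2, c3⟩ := zk_mem h hn hc.1 hc.2
  obtain ⟨-, -, t1, t2, t3, hp0⟩ := t_ku (m := n - 1) h hp hσ
  have e0 := congrFun (congrFun he 2) 0
  simp only [uhatM, tUmat, Matrix.mul_apply, Fin.sum_univ_three] at e0
  simp at e0
  have b : Bd q v n (p ^ (n - 1)) := by
    rw [← e0]
    exact h.badd (h.badd (h.bmul hy (VS.b0.2 c3.le) (by omega))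
      (h.bneg (h.bmul (h.bconj hx) c1 (by omega)))) c2
  have : Bd q v 1 (1 : E) := by
    have e : (1 : E) = p ^ (n - 1) * p ^ (-(n - 1)) := by
      rw [← zpow_add₀ hp0]; simp
    rw [e]; exact h.bmul b t2 (by omega)
  have := h.not_unit this
  rw [h.one] at this
  exact lt_irrefl _ this

theorem decomp (h : VS q σ v) {n : ℤ} (hn : 2 ≤ n) {g : Matrix (Fin 3) (Fin 3) E}
    (hg : g ∈ KUset q σ v (n - 1)) (hu : v (g 0 0) = 1) {x y : E}
    (hxy : y + σ y + x * σ x = 0) (hx : Bd q v (n - 1) x) (hy : Bd q v (n - 1) y)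
    (h1 : Bd q v n (g 1 0 - x * g 0 0)) (h2 : Bd q v n (g 2 0 - y * g 0 0)) :
    ∃ c ∈ KUset q σ v (n - 1) ∩ ZK q σ v n, g = uhatM σ x y * c := by
  have hU : uhatM σ (-x) (σ y) ∈ KUset q σ v (n - 1) :=
    uhat_ku h (by omega) (by simp [h.invol]; linear_combination hxy) (h.bneg hx) (h.bconj hy)
  have hc := ku_mul h (by omega) hU hg
  have c00 : (uhatM σ (-x) (σ y) * g) 0 0 = g 0 0 := by
    simp [uhatM, Matrix.mul_apply, Fin.sum_univ_three]
  have c10 : (uhatM σ (-x) (σ y) * g) 1 0 = g 1 0 - x * g 0 0 := by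
    simp [uhatM, Matrix.mul_apply, Fin.sum_univ_three]; ring
  have c20 : (uhatM σ (-x) (σ y) * g) 2 0 =
      (g 2 0 - y * g 0 0) + σ x * (g 1 0 - x * g 0 0) := by
    simp [uhatM, Matrix.mul_apply, Fin.sum_univ_three]
    linear_combination g 0 0 * hxy
  refine ⟨uhatM σ (-x) (σ y) * g, ⟨hc, ?_⟩, ?_⟩
  · have b1 := c10 ▸ h1
    have b2 : Bd q v n ((uhatM σ (-x) (σ y) * g) 2 0) := by
      rw [c20]
      exact h.badd h2 (h.bmul (h.bconj hx) h1 (by omega))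
    refine mem_zk h hn hc b1 b2 ?_
    rw [← c00] at hu
    rw [ku_iff] at hc
    generalize (uhatM σ (-x) (σ y) * g) = c at *
    obtain ⟨g0, g1, g2, g3, g4, g5, g6, g7, g8, g9⟩ := hc
    have r := gu_entry g0 0 1
    simp only [J3mat] at r
    simp at r
    have hu' : v (σ (c 0 0)) = 1 := by rw [h.conj, hu]
    have n1 := h.unit_ne hu'
    have e : c 2 1 = (-(σ (c 1 0) * c 1 1 + σ (c 2 0) * c 0 1)) / σ (c 0 0) := by
      rw [eq_div_iff n1]; linear_combination r
    rw [e]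
    exact h.bdiv (h.bneg (h.badd (h.bmul (h.bconj b1) (h.b11 (by omega) g5) (by omega))
      (h.bmul (h.bconj b2) g2 (by omega)))) hu'
  · rw [← Matrix.mul_assoc, uhat_inv h hxy, Matrix.one_mul]

end

/-- Lemma 4.5: the listed elements form a complete set of representatives for
`K_{n-1} / (K_{n-1} ∩ (Z_{n-1} K_n))`. -/
theorem stmt_16
    (F : Type) [Field F] [CharZero F]
    (q : ℝ) (hq : 1 < q)
    (absF : F → ℝ)
    (habsF0 : ∀ x : F, absF x = 0 ↔ x = 0)
    (habsFmul : ∀ x y : F, absF (x * y) = absF x * absF y)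
    (habsFadd : ∀ x y : F, absF (x + y) ≤ max (absF x) (absF y))
    (ϖ : F) (hϖ : absF ϖ = q⁻¹)
    (hvalF : ∀ x : F, x ≠ 0 → ∃ m : ℤ, absF x = q ^ m)
    (habsF2 : absF 2 = 1)
    (E : Type) [Field E] [Algebra F E]
    (σ : E → E)
    (hσadd : ∀ x y : E, σ (x + y) = σ x + σ y)
    (hσmul : ∀ x y : E, σ (x * y) = σ x * σ y)
    (hσinvol : ∀ x : E, σ (σ x) = x)
    (hσfix : ∀ x : F, σ (algebraMap F E x) = algebraMap F E x)
    (ε : F) (sqrtε : E)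
    (hεabs : absF ε = 1)
    (hεnonsq : ∀ a : F, a * a ≠ ε)
    (hsqrtε : sqrtε * sqrtε = algebraMap F E ε)
    (hσsqrtε : σ sqrtε = -sqrtε)
    (hspan : ∀ x : E, ∃ a b : F, x = algebraMap F E a + algebraMap F E b * sqrtε)
    (absE : E → ℝ)
    (habsE0 : ∀ x : E, absE x = 0 ↔ x = 0)
    (habsEmul : ∀ x y : E, absE (x * y) = absE x * absE y)
    (habsEadd : ∀ x y : E, absE (x + y) ≤ max (absE x) (absE y))
    (habsEF : ∀ x : F, absE (algebraMap F E x) = absF x ^ 2)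
    (habsEconj : ∀ x : E, absE (σ x) = absE x)
    (habsEspan : ∀ a b : F,
      absE (algebraMap F E a + algebraMap F E b * sqrtε) = max (absF a ^ 2) (absF b ^ 2))
    (hvalE : ∀ x : E, x ≠ 0 → ∃ m : ℤ, absE x = (q ^ 2) ^ m)
    (n : ℤ) (hn : 2 ≤ n)
    (ι₁ ι₂ : Type)
    (yr : ι₁ → E) (hyr : RepsE q absE (n - 1) n yr)
    (br : ι₂ → F) (hbr : RepsF q absF (n - 1) n br)
    (reps : ι₁ ⊕ (ι₁ × ι₂) → Matrix (Fin 3) (Fin 3) E)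
    (hreps : reps = Sum.elim
      (fun i => tUmat (algebraMap F E ϖ) (n - 1) * uhatM σ (yr i) (-(yr i * σ (yr i)) / 2))
      (fun p => uhatM σ (yr p.1)
        (algebraMap F E (br p.2) * sqrtε - yr p.1 * σ (yr p.1) / 2))) :
    IsCompleteReps (KUset q σ absE (n - 1))
      (KUset q σ absE (n - 1) ∩
        {m | ∃ c ∈ ZUset q σ absE (n - 1), ∃ k ∈ KUset q σ absE n, m = c * k})
      reps := by
  have hσ1 : σ 1 = 1 := by
    have h1 := hσmul 1 (σ 1)
    rw [one_mul, hσinvol, mul_one] at h1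
    exact h1.symm
  obtain ⟨τ, rfl⟩ : ∃ τ : E →+* E, σ = ⇑τ := by
    have hσ0 : σ 0 = 0 := by simpa using hσadd 0 0
    exact ⟨{ toFun := σ, map_one' := hσ1, map_mul' := hσmul, map_zero' := hσ0, map_add' := hσadd },
      rfl⟩
  have h : VS q τ absE :=
    { hq := hq
      zero := habsE0
      mul := habsEmul
      add := habsEadd
      conj := habsEconj
      val := hvalE
      two := by
        have := habsEF 2
        rw [habsF2, map_ofNat] at this
        simpa using this
      invol := hσinvol }
  have h2 := h.two_ne
  have hp : absE (algebraMap F E ϖ) = (q ^ 2)⁻¹ := by rw [habsEF, hϖ]; simp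
  have hps := hσfix ϖ
  obtain ⟨tK, tt, tb1, tb2, tv, hp0⟩ := t_ku (m := n - 1) h hp hps
  have hF0 : absF 0 = 0 := (habsF0 0).2 rfl
  have hbF : ∀ (b : F) (k : ℤ), Bd q absE k (algebraMap F E b * sqrtε) ↔ absF b ≤ q ^ (-k) := by
    intro b k
    have e := habsEspan 0 b
    have hb0 : 0 ≤ absF b := by
      by_cases hb : b = 0
      · rw [hb, hF0]
      · obtain ⟨m, hm⟩ := hvalF b hb
        rw [hm]; positivity
    have e2 : (q ^ 2) ^ (-k) = (q ^ (-k)) ^ 2 := by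
      rw [← zpow_natCast, ← zpow_natCast, ← _root_.zpow_mul, ← _root_.zpow_mul, mul_comm]
    rw [map_zero, zero_add, hF0] at e
    unfold Bd
    rw [e, e2, max_eq_right (by simpa using sq_nonneg (absF b)), sq_le_sq₀ hb0 (by positivity)]
  have hsk : ∀ w : E, τ w = -w → ∃ b : F, w = algebraMap F E b * sqrtε := by
    intro w hw
    obtain ⟨a, b, rfl⟩ := hspan w
    refine ⟨b, ?_⟩
    simp only [map_add, map_mul, hσfix, hσsqrtε] at hw
    have : (2 : E) * algebraMap F E a = 0 := by linear_combination hw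
    rcases mul_eq_zero.1 this with h3 | h3
    · exact absurd h3 h2
    · rw [h3, zero_add]
  obtain ⟨hy1, hy2, hy3⟩ := hyr
  obtain ⟨hb1, hb2, hb3⟩ := hbr
  have hN : ∀ x : E, Bd q absE (n - 1) x → Bd q absE n (x * τ x / 2) := fun x hx =>
    h.bdiv (h.bmul hx (h.bconj hx) (by omega)) h.two
  have hN' : ∀ x : E, Bd q absE (n - 1) x → Bd q absE n (-(x * τ x) / 2) := fun x hx => by
    rw [neg_div]; exact h.bneg (hN x hx)
  have rel1 : ∀ x : E, -(x * τ x) / 2 + τ (-(x * τ x) / 2) + x * τ x = 0 := by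
    intro x
    simp only [map_div₀, map_neg, map_mul, hσinvol, map_ofNat]
    field_simp
    ring
  have rel2 : ∀ (x : E) (b : F), (algebraMap F E b * sqrtε - x * τ x / 2) +
      τ (algebraMap F E b * sqrtε - x * τ x / 2) + x * τ x = 0 := by
    intro x b
    simp only [map_div₀, map_sub, map_mul, hσinvol, map_ofNat, hσfix, hσsqrtε]
    field_simp
    ring
  have bnd2 : ∀ i j, Bd q absE (n - 1)
      (algebraMap F E (br j) * sqrtε - yr i * τ (yr i) / 2) := fun i j =>
    h.bsub ((hbF _ _).2 (hb1 j)) (h.bmono (hN _ (hy1 i)) (by omega))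
  have tcancel : ∀ A B : Matrix (Fin 3) (Fin 3) E,
      tUmat (algebraMap F E ϖ) (n - 1) * A = B → A = tUmat (algebraMap F E ϖ) (n - 1) * B := by
    intro A B hAB
    rw [← hAB, ← Matrix.mul_assoc, tt, Matrix.one_mul]
  subst hreps
  change IsCompleteReps (KUset q τ absE (n - 1)) (KUset q τ absE (n - 1) ∩ ZK q τ absE n) _
  refine ⟨?_, ?_, ?_⟩
  · rintro (i | ⟨i, j⟩)
    · exact ku_mul h (by omega) tK
        (uhat_ku h (by omega) (rel1 _) (hy1 i) (h.bmono (hN' _ (hy1 i)) (by omega)))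
    · exact uhat_ku h (by omega) (rel2 _ _) (hy1 i) (bnd2 i j)
  · rintro (i | ⟨i, j⟩) (i' | ⟨i', j'⟩) ⟨c, hc, he⟩
    · simp only [Sum.elim_inl] at he
      rw [Matrix.mul_assoc] at he
      have he := tcancel _ _ he
      rw [← Matrix.mul_assoc, tt, Matrix.one_mul] at he
      have := (inj_aux h hn hc (hy1 i) he).1
      rw [hy2 i' i this]
    · simp only [Sum.elim_inl, Sum.elim_inr] at he
      rw [Matrix.mul_assoc] at he
      exact (ne_aux2 h hn hc hp hps (hy1 i) (hN' _ (hy1 i)) (tcancel _ _ he)).elim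
    · simp only [Sum.elim_inl, Sum.elim_inr] at he
      exact (ne_aux h hn hc hp hps (hN' _ (hy1 i')) he).elim
    · simp only [Sum.elim_inr] at he
      obtain ⟨b1, b2⟩ := inj_aux h hn hc (hy1 i) he
      have ei := hy2 i' i b1
      subst ei
      have e : algebraMap F E (br j') * sqrtε - yr i' * τ (yr i') / 2 -
          (algebraMap F E (br j) * sqrtε - yr i' * τ (yr i') / 2) =
          algebraMap F E (br j' - br j) * sqrtε := by rw [map_sub]; ring
      rw [e, hbF] at b2
      rw [hb2 j' j b2]
  · intro g hg
    have hg' := ku_iff.1 hg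
    obtain ⟨g0, g1, g2, g3, g4, g5, g6, g7, g8, g9⟩ := hg'
    by_cases hu : absE (g 0 0) = 1
    · have n0 := h.unit_ne hu
      have n0' : τ (g 0 0) ≠ 0 := by simpa using n0
      have r := gu_entry g0 0 0
      simp only [J3mat] at r
      simp at r
      obtain ⟨a, ha⟩ : ∃ a, a = g 1 0 / g 0 0 := ⟨_, rfl⟩
      obtain ⟨y, hy⟩ : ∃ y, y = g 2 0 / g 0 0 := ⟨_, rfl⟩
      have ba : Bd q absE (n - 1) a := ha ▸ h.bdiv g4 hu
      have bY : Bd q absE (n - 1) y := hy ▸ h.bdiv g7 hu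
      have hay : y + τ y + a * τ a = 0 := by
        rw [ha, hy, map_div₀, map_div₀]
        field_simp
        linear_combination r
      have ha' : g 1 0 = a * g 0 0 := by rw [ha]; field_simp
      have hy' : g 2 0 = y * g 0 0 := by rw [hy]; field_simp
      obtain ⟨b, hb⟩ := hsk (y + a * τ a / 2) (by
        simp only [map_div₀, map_add, map_mul, hσinvol, map_ofNat]
        field_simp
        linear_combination 2 * hay)
      have bb : absF b ≤ q ^ (-(n - 1)) := by
        rw [← hbF, ← hb]
        exact h.badd bY (h.bmono (hN a ba) (by omega))
      obtain ⟨i, hi⟩ := hy3 a ba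
      obtain ⟨j, hj⟩ := hb3 b bb
      rw [← hbF, map_sub] at hj
      refine ⟨Sum.inr (i, j), ?_⟩
      refine decomp h hn hg hu (rel2 _ _) (hy1 i) (bnd2 i j) ?_ ?_
      · rw [ha', ← sub_mul]
        exact h.bmul hi g1 (by omega)
      · rw [hy', ← sub_mul]
        refine h.bmul (a := n) ?_ g1 (by omega)
        have e : y - (algebraMap F E (br j) * sqrtε - yr i * τ (yr i) / 2) =
          (algebraMap F E b - algebraMap F E (br j)) * sqrtε +
            (yr i * τ (yr i) / 2 - a * τ a / 2) := by linear_combination hb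
        change Bd q absE n (y - (algebraMap F E (br j) * sqrtε - yr i * τ (yr i) / 2))
        rw [e]
        exact h.badd hj (h.bsub (hN _ (hy1 i)) (hN _ ba))
    · have lt : absE (g 0 0) < 1 := lt_of_le_of_ne (VS.b0.1 g1) hu
      have b00 := h.lt_one lt
      have hk := ku_mul h (by omega) tK hg
      have k00 : (tUmat (algebraMap F E ϖ) (n - 1) * g) 0 0 =
          algebraMap F E ϖ ^ (-(n - 1)) * g 2 0 := by
        simp [tUmat, Matrix.mul_apply, Fin.sum_univ_three]
      have k20 : (tUmat (algebraMap F E ϖ) (n - 1) * g) 2 0 =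
          algebraMap F E ϖ ^ (n - 1) * g 0 0 := by
        simp [tUmat, Matrix.mul_apply, Fin.sum_univ_three]
      have b20 : Bd q absE n ((tUmat (algebraMap F E ϖ) (n - 1) * g) 2 0) := by
        rw [k20]; exact h.bmul tb1 b00 (by omega)
      have ku := ku_iff.1 hk
      have ku00 : absE ((tUmat (algebraMap F E ϖ) (n - 1) * g) 0 0) = 1 := by
        obtain ⟨m0, m1, m2, m3, m4, m5, m6, m7, m8, m9⟩ := ku
        by_contra hne
        have b := h.lt_one (lt_of_le_of_ne (VS.b0.1 m1) hne)
        have r := gu_entry m0 0 2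
        simp only [J3mat] at r
        simp only [Matrix.of_apply, Matrix.cons_val] at r
        have : Bd q absE 1 (1 : E) := by
          rw [← r]
          exact h.badd (h.badd (h.bmul (h.bconj b) m9 (by omega))
            (h.bmul (h.bconj m4) m6 (by omega))) (h.bmul (h.bconj b20) m3 (by omega))
        have := h.not_unit this
        rw [h.one] at this
        exact lt_irrefl _ this
      obtain ⟨m0, m1, m2, m3, m4, m5, m6, m7, m8, m9⟩ := ku
      have ht : g = tUmat (algebraMap F E ϖ) (n - 1) * (tUmat (algebraMap F E ϖ) (n - 1) * g) := by
        rw [← Matrix.mul_assoc, tt, Matrix.one_mul]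
      generalize tUmat (algebraMap F E ϖ) (n - 1) * g = k at *
      have n0 := h.unit_ne ku00
      obtain ⟨i, hi⟩ := hy3 (k 1 0 / k 0 0) (h.bdiv m4 ku00)
      obtain ⟨c, hc, hkc⟩ := decomp h hn hk ku00 (rel1 (yr i)) (hy1 i)
        (h.bmono (hN' _ (hy1 i)) (by omega))
        (by
          have e : k 1 0 - yr i * k 0 0 = (k 1 0 / k 0 0 - yr i) * k 0 0 := by field_simp
          rw [e]
          exact h.bmul hi m1 (by omega))
        (h.bsub b20 (h.bmul (hN' _ (hy1 i)) m1 (by omega)))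
      refine ⟨Sum.inl i, c, hc, ?_⟩
      rw [ht, hkc]
      simp only [Sum.elim_inl, Matrix.mul_assoc]
end
end

section
/- Let n ≥ 2 and let K'' = {g ∈ G : g₁₁, g₁₂ ∈ o_E, g₁₃ ∈ p_E^{1−n}, g₂₁ ∈ p_E^{n−1}, g₂₂ ∈ 1+p_E^{n−1}, g₂₃ ∈ o_E, g₃₁ ∈ p_E^n, g₃₂ ∈ p_E^{n−1}, g₃₃ ∈ o_E}. Then the q+1 elements t_{n−1} and û(0, x√ε), where x runs over a set of representatives of p_F^{n−1}/p_F^n, form a complete set of representatives for the left coset space K_{n−1} / K''. -/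
set_option autoImplicit false

open MeasureTheory Matrix

noncomputable section

theorem GUset_mul_mem {E : Type} [Field E] (s : E →+* E) (a g : Matrix (Fin 3) (Fin 3) E)
    (ha : a ∈ GUset (s : E → E)) (hg : g ∈ GUset (s : E → E)) : a * g ∈ GUset (s : E → E) := by
  simp only [GUset, Set.mem_ofPred_eq] at *
  rw [Matrix.map_mul, Matrix.transpose_mul]
  calc _ = (g.map s)ᵀ * ((a.map s)ᵀ * J3mat E * a) * g := by simp only [Matrix.mul_assoc]
    _ = _ := by rw [ha, hg]

theorem uhat_mem_GU {E : Type} [Field E] (s : E →+* E) (y : E) (hy : s y = -y) :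
    uhatM s 0 y ∈ GUset (s : E → E) := by
  simp only [GUset, Set.mem_ofPred_eq, uhatM, J3mat]
  ext i j
  fin_cases i <;> fin_cases j <;>
    simp [Matrix.mul_apply, Fin.sum_univ_three, hy]

theorem t_mem_GU {E : Type} [Field E] (s : E →+* E) (p : E) (hp : s p = p) (h0 : p ≠ 0) (m : ℤ) :
    tUmat p m ∈ GUset (s : E → E) := by
  have h1 : p ^ (-m) * p ^ m = 1 := by rw [← zpow_add₀ h0]; simp
  have h2 : p ^ m * p ^ (-m) = 1 := by rw [← zpow_add₀ h0]; simp
  simp only [GUset, Set.mem_ofPred_eq, tUmat, J3mat]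
  ext i j
  fin_cases i <;> fin_cases j <;>
    simp [Matrix.mul_apply, Fin.sum_univ_three, hp, map_zpow₀, mul_inv_cancel₀ (zpow_ne_zero m h0),
      inv_mul_cancel₀ (zpow_ne_zero m h0)]

theorem uhat_mul_cancel {E : Type} [Field E] (s : E →+* E) (y : E) (g : Matrix (Fin 3) (Fin 3) E) :
    uhatM s 0 y * (uhatM s 0 (-y) * g) = g := by
  rw [← Matrix.mul_assoc]
  have : uhatM s 0 y * uhatM s 0 (-y) = 1 := by
    ext i j
    fin_cases i <;> fin_cases j <;>
      simp [uhatM, Matrix.mul_apply, Fin.sum_univ_three]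
  rw [this, Matrix.one_mul]

theorem t_mul_row0 {E : Type} [Field E] (p : E) (m : ℤ)
    (g : Matrix (Fin 3) (Fin 3) E) (j : Fin 3) : (tUmat p m * g) 0 j = p ^ (-m) * g 2 j := by
  simp [tUmat, Matrix.mul_apply, Fin.sum_univ_three]

theorem t_mul_row1 {E : Type} [Field E] (p : E) (m : ℤ)
    (g : Matrix (Fin 3) (Fin 3) E) (j : Fin 3) : (tUmat p m * g) 1 j = g 1 j := by
  simp [tUmat, Matrix.mul_apply, Fin.sum_univ_three]

theorem t_mul_row2 {E : Type} [Field E] (p : E) (m : ℤ)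
    (g : Matrix (Fin 3) (Fin 3) E) (j : Fin 3) : (tUmat p m * g) 2 j = p ^ m * g 0 j := by
  simp [tUmat, Matrix.mul_apply, Fin.sum_univ_three]

theorem t_mul_cancel {E : Type} [Field E] (p : E) (h0 : p ≠ 0) (m : ℤ)
    (g : Matrix (Fin 3) (Fin 3) E) : tUmat p m * (tUmat p m * g) = g := by
  rw [← Matrix.mul_assoc]
  have : tUmat p m * tUmat p m = 1 := by
    ext i j
    fin_cases i <;> fin_cases j <;>
      simp [tUmat, Matrix.mul_apply, Fin.sum_univ_three, mul_inv_cancel₀ (zpow_ne_zero m h0),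
        inv_mul_cancel₀ (zpow_ne_zero m h0)]
  rw [this, Matrix.one_mul]

theorem le_of_sq_le_sq_aux {a b : ℝ} (h : a ^ 2 ≤ b ^ 2) (hb : 0 ≤ b) : a ≤ b :=
  (le_abs_self a).trans (abs_le_of_sq_le_sq h hb)

/-- The `q+1` elements `t_{n-1}` and `û(0, x√ε)` form a complete set of representatives
for `K_{n-1} / K''`. -/
theorem stmt_17
    (F : Type) [Field F] [CharZero F]
    (q : ℝ) (hq : 1 < q)
    (absF : F → ℝ)
    (habsF0 : ∀ x : F, absF x = 0 ↔ x = 0)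
    (habsFmul : ∀ x y : F, absF (x * y) = absF x * absF y)
    (habsFadd : ∀ x y : F, absF (x + y) ≤ max (absF x) (absF y))
    (ϖ : F) (hϖ : absF ϖ = q⁻¹)
    (hvalF : ∀ x : F, x ≠ 0 → ∃ m : ℤ, absF x = q ^ m)
    (habsF2 : absF 2 = 1)
    (E : Type) [Field E] [Algebra F E]
    (σ : E → E)
    (hσadd : ∀ x y : E, σ (x + y) = σ x + σ y)
    (hσmul : ∀ x y : E, σ (x * y) = σ x * σ y)
    (hσinvol : ∀ x : E, σ (σ x) = x)
    (hσfix : ∀ x : F, σ (algebraMap F E x) = algebraMap F E x)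
    (ε : F) (sqrtε : E)
    (hεabs : absF ε = 1)
    (hεnonsq : ∀ a : F, a * a ≠ ε)
    (hsqrtε : sqrtε * sqrtε = algebraMap F E ε)
    (hσsqrtε : σ sqrtε = -sqrtε)
    (hspan : ∀ x : E, ∃ a b : F, x = algebraMap F E a + algebraMap F E b * sqrtε)
    (absE : E → ℝ)
    (habsE0 : ∀ x : E, absE x = 0 ↔ x = 0)
    (habsEmul : ∀ x y : E, absE (x * y) = absE x * absE y)
    (habsEadd : ∀ x y : E, absE (x + y) ≤ max (absE x) (absE y))
    (habsEF : ∀ x : F, absE (algebraMap F E x) = absF x ^ 2)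
    (habsEconj : ∀ x : E, absE (σ x) = absE x)
    (habsEspan : ∀ a b : F,
      absE (algebraMap F E a + algebraMap F E b * sqrtε) = max (absF a ^ 2) (absF b ^ 2))
    (hvalE : ∀ x : E, x ≠ 0 → ∃ m : ℤ, absE x = (q ^ 2) ^ m)
    (n : ℤ) (hn : 2 ≤ n)
    (ι : Type) (xr : ι → F) (hxr : RepsF q absF (n - 1) n xr)
    (reps : Option ι → Matrix (Fin 3) (Fin 3) E)
    (hreps : reps = fun o => o.elim (tUmat (algebraMap F E ϖ) (n - 1))
      (fun i => uhatM σ 0 (algebraMap F E (xr i) * sqrtε))) :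
    IsCompleteReps (KUset q σ absE (n - 1))
      {g : Matrix (Fin 3) (Fin 3) E | g ∈ GUset σ ∧ absE (g 0 0) ≤ 1 ∧ absE (g 0 1) ≤ 1 ∧
        absE (g 0 2) ≤ (q ^ 2) ^ (n - 1) ∧ absE (g 1 0) ≤ (q ^ 2) ^ (1 - n) ∧
        absE (g 1 1 - 1) ≤ (q ^ 2) ^ (1 - n) ∧ absE (g 1 2) ≤ 1 ∧
        absE (g 2 0) ≤ (q ^ 2) ^ (-n) ∧ absE (g 2 1) ≤ (q ^ 2) ^ (1 - n) ∧ absE (g 2 2) ≤ 1}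
      reps := by
  obtain ⟨s, rfl⟩ : ∃ s : E →+* E, σ = s := by
    have h1 : σ 1 = 1 := by simpa using hσfix 1
    have h0 : σ 0 = 0 := by simpa using hσfix 0
    exact ⟨⟨⟨⟨σ, h1⟩, hσmul⟩, h0, hσadd⟩, rfl⟩
  obtain ⟨m, rfl⟩ : ∃ m : ℤ, n = m + 1 := ⟨n - 1, by ring⟩
  have hm1 : m + 1 - 1 = m := by ring
  have hm2 : 1 - (m + 1) = -m := by ring
  rw [hm1] at hreps hxr
  rw [hm1, hm2]
  obtain ⟨hx1, hx2, hx3⟩ := hxr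
  have hq0 : 0 < q := by linarith
  have hQ1 : 1 < q ^ 2 := by nlinarith
  set Q : ℝ := q ^ 2 with hQdef
  have hQ0 : 0 < Q := by linarith
  have hmpos : 1 ≤ m := by linarith
  have F0 : absF 0 = 0 := (habsF0 0).2 rfl
  have E0 : absE 0 = 0 := (habsE0 0).2 rfl
  have F1 : absF 1 = 1 := by
    have h := habsFmul 1 1
    have h' : absF 1 ≠ 0 := fun h => one_ne_zero ((habsF0 1).1 h)
    rw [mul_one] at h
    exact (mul_right_cancel₀ h' (by rw [one_mul]; exact h)).symm
  have E1 : absE 1 = 1 := by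
    have := habsEF 1
    rwa [map_one, F1, one_pow] at this
  have Fnn : ∀ x : F, 0 ≤ absF x := by
    intro x
    by_cases h : x = 0
    · rw [h, F0]
    · obtain ⟨k, hk⟩ := hvalF x h
      rw [hk]; positivity
  have Enn : ∀ x : E, 0 ≤ absE x := by
    intro x
    by_cases h : x = 0
    · rw [h, E0]
    · obtain ⟨k, hk⟩ := hvalE x h
      rw [hk]; positivity
  have Es : absE sqrtε = 1 := by
    have := habsEspan 0 1
    simpa [F0, F1] using this
  have Eneg1 : absE (-1) = 1 := by
    have := habsEF (-1)
    have h2 : absF (-1) * absF (-1) = 1 := by rw [← habsFmul]; simp [F1]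
    rw [map_neg, map_one] at this
    rw [this, sq, h2]
  have Eneg : ∀ x, absE (-x) = absE x := by
    intro x
    rw [show -x = -1 * x by ring, habsEmul, Eneg1, one_mul]
  have qQ : ∀ k : ℤ, (q ^ k) ^ 2 = Q ^ k := by
    intro k
    rw [hQdef, ← zpow_natCast, ← zpow_natCast, ← _root_.zpow_mul, ← _root_.zpow_mul, mul_comm]
  set p : E := algebraMap F E ϖ with hp
  have Ep : absE p = Q⁻¹ := by rw [hp, habsEF, hϖ, hQdef, inv_pow]
  have hp0 : p ≠ 0 := by
    intro h
    rw [h, E0] at Ep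
    have : (0:ℝ) < Q⁻¹ := by positivity
    linarith
  have sp : s p = p := hσfix ϖ
  have Epz : ∀ k : ℤ, absE (p ^ k) = Q ^ (-k) := by
    let f : E →*₀ ℝ := ⟨⟨absE, E0⟩, E1, habsEmul⟩
    intro k
    have := map_zpow₀ f p k
    have h2 : f p = Q⁻¹ := Ep
    rw [h2, _root_.inv_zpow'] at this
    exact this
  have hAm : Q ^ m * Q ^ (-m) = 1 := by rw [← zpow_add₀ hQ0.ne']; simp
  have hAm' : Q ^ (-m) * Q ^ m = 1 := by rw [mul_comm, hAm]
  have hApos : 0 < Q ^ (-m) := by positivity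
  have hBpos : 0 < Q ^ m := by positivity
  have hA1 : Q ^ (-m) ≤ 1 := zpow_le_one_of_nonpos₀ hQ1.le (by linarith)
  have hlt : Q ^ (-(m + 1)) < Q ^ (-m) := zpow_lt_zpow_right₀ hQ1 (by linarith)
  have sy : ∀ x : F, s (algebraMap F E x * sqrtε) = -(algebraMap F E x * sqrtε) := by
    intro x
    rw [map_mul, hσfix, hσsqrtε]; ring
  have Ey : ∀ x : F, absE (algebraMap F E x * sqrtε) = absF x ^ 2 := by
    intro x
    rw [habsEmul, habsEF, Es, mul_one]
  have Eyr : ∀ i, absE (algebraMap F E (xr i) * sqrtε) ≤ Q ^ (-m) := by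
    intro i
    rw [Ey, ← qQ]
    exact pow_le_pow_left₀ (Fnn _) (hx1 i) 2
  have hcalc : ∀ (u v : E) (a b c : ℝ), absE u ≤ a → absE v ≤ b → 0 ≤ a → a * b ≤ c →
      absE (u * v) ≤ c := by
    intro u v a b c hu hv ha h
    rw [habsEmul]
    exact (mul_le_mul hu hv (Enn _) ha).trans h
  have hadd : ∀ (u v : E) (c : ℝ), absE u ≤ c → absE v ≤ c → absE (u + v) ≤ c :=
    fun u v c hu hv => (habsEadd u v).trans (max_le hu hv)
  subst hreps
  refine ⟨?_, ?_, ?_⟩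
  · rintro (_ | i)
    · refine ⟨t_mem_GU s p sp hp0 m, ?_⟩
      have c1 : absE (p ^ (-m)) ≤ Q ^ m := by rw [Epz, neg_neg]
      have c2 : absE (p ^ m) ≤ Q ^ (-m) := (Epz m).le
      have z1 : absE (0 : E) ≤ 1 := by rw [E0]; exact zero_le_one
      have z2 : absE (0 : E) ≤ Q ^ (-m) := by rw [E0]; exact hApos.le
      have z3 : absE ((1 : E) - 1) ≤ Q ^ (-m) := by rw [sub_self]; exact z2
      exact ⟨z1, z1, c1, z2, z3, z1, c2, z2, z1⟩
    · refine ⟨uhat_mem_GU s _ (sy _), ?_⟩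
      have := Eyr i
      have z1 : absE (0 : E) ≤ 1 := by rw [E0]; exact zero_le_one
      have o1 : absE (1 : E) ≤ 1 := E1.le
      have z2 : absE (0 : E) ≤ Q ^ (-m) := by rw [E0]; exact hApos.le
      have z4 : absE (0 : E) ≤ Q ^ m := by rw [E0]; exact hBpos.le
      have z3 : absE ((1 : E) - 1) ≤ Q ^ (-m) := by rw [sub_self]; exact z2
      have z5 : absE (-s 0) ≤ Q ^ (-m) := by rw [map_zero, neg_zero]; exact z2
      exact ⟨o1, z1, z4, z2, z3, z1, this, z5, o1⟩
  · rintro (_ | i) (_ | j) ⟨c, ⟨-, -, -, -, -, -, -, hc, -, -⟩, h⟩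
    · rfl
    · exfalso
      have h00 := congrFun (congrFun h 0) 0
      have e0 : (tUmat p m * c) 0 0 = 1 := h00
      rw [t_mul_row0] at e0
      have h1 : absE (p ^ (-m) * c 2 0) = 1 := by rw [e0, E1]
      rw [habsEmul, Epz, neg_neg] at h1
      have : Q ^ m * absE (c 2 0) < Q ^ m * Q ^ (-m) :=
        mul_lt_mul_of_pos_left (hc.trans_lt hlt) hBpos
      linarith
    · exfalso
      have h00 := congrFun (congrFun h 0) 0
      have h20 := congrFun (congrFun h 2) 0
      simp [tUmat, uhatM, Matrix.mul_apply, Fin.sum_univ_three] at h00 h20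
      rw [h00, mul_zero, zero_add] at h20
      rw [h20, Epz] at hc
      linarith
    · have h00 := congrFun (congrFun h 0) 0
      have h20 := congrFun (congrFun h 2) 0
      simp [uhatM, Matrix.mul_apply, Fin.sum_univ_three] at h00 h20
      rw [h00, mul_one] at h20
      have h3 : c 2 0 = algebraMap F E (xr j - xr i) * sqrtε := by
        rw [map_sub]; linear_combination h20
      rw [h3, Ey, ← qQ] at hc
      rw [hx2 j i (le_of_sq_le_sq_aux hc (by positivity))]
  · rintro g ⟨hgG, h00, h01, h02, h10, h11, h12, h20, h21, h22⟩
    by_cases ha : absE (g 0 0) < 1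
    · refine ⟨none, tUmat p m * g, ⟨GUset_mul_mem s _ _ (t_mem_GU s p sp hp0 m) hgG, ?_⟩,
        (t_mul_cancel p hp0 m g).symm⟩
      have ha' : absE (g 0 0) ≤ Q ^ (-1 : ℤ) := by
        by_cases hz : g 0 0 = 0
        · rw [hz, E0]; positivity
        · obtain ⟨k, hk⟩ := hvalE _ hz
          rw [hk] at ha ⊢
          have : k < 0 := by
            by_contra hk0
            exact absurd (one_le_zpow₀ hQ1.le (not_lt.1 hk0)) (not_le.2 ha)
          exact zpow_le_zpow_right₀ hQ1.le (by omega)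
      have hAB : Q ^ (-m) * Q ^ (-1 : ℤ) = Q ^ (-(m + 1)) := by
        rw [← zpow_add₀ hQ0.ne']; congr 1; ring
      have e1 : absE (p ^ (-m)) ≤ Q ^ m := by rw [Epz, neg_neg]
      have e2 : absE (p ^ m) ≤ Q ^ (-m) := by rw [Epz]
      rw [t_mul_row0, t_mul_row0, t_mul_row0, t_mul_row1, t_mul_row1, t_mul_row1,
        t_mul_row2, t_mul_row2, t_mul_row2]
      exact ⟨hcalc _ _ _ _ _ e1 h20 hBpos.le hAm.le, hcalc _ _ _ _ _ e1 h21 hBpos.le hAm.le,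
        hcalc _ _ _ _ _ e1 h22 hBpos.le (mul_one _).le, h10, h11, h12,
        hcalc _ _ _ _ _ e2 ha' hApos.le hAB.le,
        hcalc _ _ _ _ _ e2 h01 hApos.le (mul_one _).le,
        hcalc _ _ _ _ _ e2 h02 hApos.le hAm'.le⟩
    · have ha1 : absE (g 0 0) = 1 := le_antisymm h00 (not_lt.1 ha)
      have hz : g 0 0 ≠ 0 := fun h => by rw [h, E0] at ha1; exact zero_ne_one ha1
      obtain ⟨y0, y1, hy⟩ := hspan (g 2 0 / g 0 0)
      have hy' : g 2 0 = g 0 0 * (algebraMap F E y0 + algebraMap F E y1 * sqrtε) := by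
        rw [← hy]; field_simp
      have hyabs : max (absF y0 ^ 2) (absF y1 ^ 2) ≤ Q ^ (-m) := by
        rw [← habsEspan]
        have := h20
        rwa [hy', habsEmul, ha1, one_mul] at this
      have hy1 : absF y1 ≤ q ^ (-m) := by
        refine le_of_sq_le_sq_aux ?_ (by positivity)
        rw [qQ]; exact (le_max_right _ _).trans hyabs
      have hy0 : absF y0 ^ 2 ≤ Q ^ (-(m + 1)) := by
        have hG := congrFun (congrFun hgG 0) 0
        simp [J3mat, Matrix.mul_apply, Fin.sum_univ_three] at hG
        rw [hy', map_mul, map_add, sy, hσfix] at hG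
        have hG2 : s (g 0 0) * g 0 0 * algebraMap F E (2 * y0) = -(s (g 1 0) * g 1 0) := by
          rw [map_mul, map_ofNat]; linear_combination hG
        have h3 := congrArg absE hG2
        rw [Eneg, habsEmul, habsEmul, habsEmul, habsEconj, habsEconj, ha1, habsEF, habsFmul,
          habsF2, one_mul, one_mul, one_mul] at h3
        rw [h3]
        calc _ ≤ Q ^ (-m) * Q ^ (-m) := mul_le_mul h10 h10 (Enn _) hApos.le
          _ = Q ^ (-m + -m) := (zpow_add₀ hQ0.ne' _ _).symm
          _ ≤ _ := zpow_le_zpow_right₀ hQ1.le (by omega)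
      obtain ⟨i, hi⟩ := hx3 y1 hy1
      have hi2 : absF (y1 - xr i) ^ 2 ≤ Q ^ (-(m + 1)) := by
        rw [← qQ]; exact pow_le_pow_left₀ (Fnn _) hi 2
      set y : E := algebraMap F E (xr i) * sqrtε with hydef
      have hny : s (-y) = - -y := by rw [map_neg, sy]
      refine ⟨some i, uhatM s 0 (-y) * g, ⟨GUset_mul_mem s _ _ (uhat_mem_GU s _ hny) hgG, ?_⟩,
        (uhat_mul_cancel s y g).symm⟩
      have e : absE (-y) ≤ Q ^ (-m) := by rw [Eneg]; exact Eyr i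
      have k20 : -y * g 0 0 + g 2 0
          = g 0 0 * (algebraMap F E y0 + algebraMap F E (y1 - xr i) * sqrtε) := by
        rw [hy', hydef, map_sub]; ring
      have f20 : absE (-y * g 0 0 + g 2 0) ≤ Q ^ (-(m + 1)) := by
        rw [k20, habsEmul, ha1, one_mul, habsEspan]
        exact max_le hy0 hi2
      have f21 : absE (-y * g 0 1 + g 2 1) ≤ Q ^ (-m) :=
        hadd _ _ _ (hcalc _ _ _ _ _ e h01 hApos.le (mul_one _).le) h21
      have f22 : absE (-y * g 0 2 + g 2 2) ≤ 1 :=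
        hadd _ _ _ (hcalc _ _ _ _ _ e h02 hApos.le hAm'.le) h22
      have r0 : ∀ j, (uhatM s 0 (-y) * g) 0 j = g 0 j := by
        intro j; simp [uhatM, Matrix.mul_apply, Fin.sum_univ_three]
      have r1 : ∀ j, (uhatM s 0 (-y) * g) 1 j = g 1 j := by
        intro j; simp [uhatM, Matrix.mul_apply, Fin.sum_univ_three]
      have r2 : ∀ j, (uhatM s 0 (-y) * g) 2 j = -y * g 0 j + g 2 j := by
        intro j; simp [uhatM, Matrix.mul_apply, Fin.sum_univ_three]
      rw [r0, r0, r0, r1, r1, r1, r2, r2, r2]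
      exact ⟨h00, h01, h02, h10, h11, h12, f20, f21, f22⟩
end
end

section
/- Let n ≥ 2, let (π, V) be a representation of G on a complex vector space (a group homomorphism π: G → GL(V)), and let v ∈ V be fixed by K_n and by Z_{n−1}. Define δv = Σ_k π(k)v, where k runs over the complete set of representatives for K_{n−1}/(K_{n−1} ∩ (Z_{n−1}·K_n)) consisting of the elements t_{n−1}·û(y, −yȳ/2) (y over p_E^{n−1}/p_E^n) and û(a, b√ε − aā/2) (a over p_E^{n−1}/p_E^n, b over p_F^{n−1}/p_F^n), and define v' = Σ_{y ∈ p_E^{n−1}/p_E^n} Σ_{z ∈ p_F^{n−1}/p_F^n} π(û(y, z√ε − yȳ/2))v. Then δv = v' + Σ_{y ∈ p_E^{-1}/o_E} π(ζ·u(y, −yȳ/2))v. -/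
set_option autoImplicit false

open MeasureTheory Matrix

noncomputable section

/-- Explicit description of the level lowering operator:
`δv = v' + Σ_{y ∈ p_E^{-1}/o_E} π(ζ u(y, -yȳ/2)) v`. -/
theorem stmt_18
    (F : Type) [Field F] [CharZero F]
    (q : ℝ) (hq : 1 < q)
    (absF : F → ℝ)
    (habsF0 : ∀ x : F, absF x = 0 ↔ x = 0)
    (habsFmul : ∀ x y : F, absF (x * y) = absF x * absF y)
    (habsFadd : ∀ x y : F, absF (x + y) ≤ max (absF x) (absF y))
    (ϖ : F) (hϖ : absF ϖ = q⁻¹)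
    (hvalF : ∀ x : F, x ≠ 0 → ∃ m : ℤ, absF x = q ^ m)
    (habsF2 : absF 2 = 1)
    (E : Type) [Field E] [Algebra F E]
    (σ : E → E)
    (hσadd : ∀ x y : E, σ (x + y) = σ x + σ y)
    (hσmul : ∀ x y : E, σ (x * y) = σ x * σ y)
    (hσinvol : ∀ x : E, σ (σ x) = x)
    (hσfix : ∀ x : F, σ (algebraMap F E x) = algebraMap F E x)
    (ε : F) (sqrtε : E)
    (hεabs : absF ε = 1)
    (hεnonsq : ∀ a : F, a * a ≠ ε)
    (hsqrtε : sqrtε * sqrtε = algebraMap F E ε)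
    (hσsqrtε : σ sqrtε = -sqrtε)
    (hspan : ∀ x : E, ∃ a b : F, x = algebraMap F E a + algebraMap F E b * sqrtε)
    (absE : E → ℝ)
    (habsE0 : ∀ x : E, absE x = 0 ↔ x = 0)
    (habsEmul : ∀ x y : E, absE (x * y) = absE x * absE y)
    (habsEadd : ∀ x y : E, absE (x + y) ≤ max (absE x) (absE y))
    (habsEF : ∀ x : F, absE (algebraMap F E x) = absF x ^ 2)
    (habsEconj : ∀ x : E, absE (σ x) = absE x)
    (habsEspan : ∀ a b : F,
      absE (algebraMap F E a + algebraMap F E b * sqrtε) = max (absF a ^ 2) (absF b ^ 2))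
    (hvalE : ∀ x : E, x ≠ 0 → ∃ m : ℤ, absE x = (q ^ 2) ^ m)
    (n : ℤ) (hn : 2 ≤ n)
    (ι₄ ι₅ ι₆ : Type) [Fintype ι₄] [Fintype ι₅] [Fintype ι₆]
    (wr : ι₄ → E) (hwr : RepsE q absE (n - 1) n wr)
    (cr : ι₅ → F) (hcr : RepsF q absF (n - 1) n cr)
    (er : ι₆ → E) (her : RepsE q absE (-1) 0 er)
    (V : Type) [AddCommGroup V] [Module ℂ V]
    (ρ : Matrix (Fin 3) (Fin 3) E → Module.End ℂ V)
    (hρone : ρ 1 = 1)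
    (hρmul : ∀ g ∈ GUset σ, ∀ h ∈ GUset σ, ρ (g * h) = ρ g * ρ h)
    (hρunit : ∀ g ∈ GUset σ, IsUnit (ρ g))
    (v : V) (hv : ∀ k ∈ KUset q σ absE n, ρ k v = v)
    (hvZ : ∀ c ∈ ZUset q σ absE (n - 1), ρ c v = v) :
    ((∑ i : ι₄, ρ (tUmat (algebraMap F E ϖ) (n - 1) *
        uhatM σ (wr i) (-(wr i * σ (wr i)) / 2)) v) +
      ∑ p : ι₄ × ι₅, ρ (uhatM σ (wr p.1)
        (algebraMap F E (cr p.2) * sqrtε - wr p.1 * σ (wr p.1) / 2)) v)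
    = (∑ p : ι₄ × ι₅, ρ (uhatM σ (wr p.1)
        (algebraMap F E (cr p.2) * sqrtε - wr p.1 * σ (wr p.1) / 2)) v) +
      ∑ i : ι₆, ρ (zUmat (algebraMap F E ϖ) * uM σ (er i) (-(er i * σ (er i)) / 2)) v := by
  classical
  obtain ⟨s, rfl⟩ : ∃ s : E →+* E, ⇑s = σ := by
    have h0 : σ 0 = 0 := by simpa using hσadd 0 0
    have h1 : σ 1 = 1 := by simpa using hσfix 1
    exact ⟨⟨⟨⟨σ, h1⟩, hσmul⟩, h0, hσadd⟩, rfl⟩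
  have hF1 : absF 1 = 1 := by
    have h := habsFmul 2 1
    rw [mul_one, habsF2, one_mul] at h
    exact h.symm
  have hE1 : absE 1 = 1 := by
    have h := habsEF 1
    rw [map_one, hF1] at h
    simpa using h
  have hE2 : absE 2 = 1 := by
    have h := habsEF 2
    rw [map_ofNat, habsF2] at h
    simpa using h
  have hEnn : ∀ x, 0 ≤ absE x := fun x => by
    by_cases hx : x = 0
    · rw [(habsE0 x).2 hx]
    · obtain ⟨m, hm⟩ := hvalE x hx
      rw [hm]; positivity
  have hEneg : ∀ x, absE (-x) = absE x := fun x => by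
    have h : absE (-1) = 1 := by
      have h := habsEmul (-1) (-1)
      rw [neg_one_mul, neg_neg, hE1] at h
      nlinarith [hEnn (-1)]
    rw [← neg_one_mul, habsEmul, h, one_mul]
  have hEsub : ∀ x y c, absE x ≤ c → absE y ≤ c → absE (x - y) ≤ c := fun x y c hx hy => by
    rw [sub_eq_add_neg]
    exact (habsEadd _ _).trans (max_le hx (by rwa [hEneg]))
  have h20 : (2 : E) ≠ 0 := fun h => by
    rw [(habsE0 2).2 h] at hE2; norm_num at hE2
  have hEhalf : ∀ x, absE (x / 2) = absE x := fun x => by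
    have h := habsEmul (x / 2) 2
    rw [div_mul_cancel₀ _ h20, hE2, mul_one] at h
    exact h.symm
  have hq0 : (0 : ℝ) < q := by linarith
  have hQ1 : (1 : ℝ) ≤ q ^ 2 := by nlinarith
  have hQ0 : (q ^ 2 : ℝ) ≠ 0 := by positivity
  obtain ⟨p, hp⟩ : ∃ p, algebraMap F E ϖ = p := ⟨_, rfl⟩
  have hpabs : absE p = (q ^ 2)⁻¹ := by rw [← hp, habsEF, hϖ, inv_pow]
  have hsp : s p = p := by rw [← hp, hσfix]
  have hp0 : p ≠ 0 := fun h => by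
    rw [(habsE0 p).2 h] at hpabs
    exact (inv_ne_zero hQ0) hpabs.symm
  have hpinv : ∀ a, a ≠ 0 → absE a⁻¹ = (absE a)⁻¹ := fun a ha => by
    have h := habsEmul a a⁻¹
    rw [mul_inv_cancel₀ ha, hE1] at h
    exact eq_inv_of_mul_eq_one_right h.symm
  have hpz : ∀ m : ℤ, absE (p ^ m) = (q ^ 2) ^ (-m) := by
    have hN : ∀ m : ℕ, absE (p ^ m) = ((q ^ 2) ^ m)⁻¹ := fun m => by
      induction m with
      | zero => simpa using hE1
      | succ k ih => rw [pow_succ, habsEmul, ih, hpabs, ← mul_inv, ← pow_succ]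
    intro m
    obtain ⟨k, rfl | rfl⟩ := m.eq_nat_or_neg
    · rw [zpow_natCast, hN, _root_.zpow_neg, zpow_natCast]
    · rw [_root_.zpow_neg, zpow_natCast, hpinv _ (pow_ne_zero _ hp0), hN, neg_neg, zpow_natCast, inv_inv]
  have hspz : ∀ m : ℤ, s (p ^ m) = p ^ m := fun m => by rw [map_zpow₀, hsp]
  rw [hp, add_comm]
  congr 1
  -- membership facts
  have gmul : ∀ g ∈ GUset s, ∀ h ∈ GUset s, g * h ∈ GUset s := by
    intro g hg h hh
    simp only [GUset, Set.mem_ofPred_eq] at *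
    rw [Matrix.map_mul, Matrix.transpose_mul]
    calc _ = (h.map s)ᵀ * ((g.map s)ᵀ * J3mat E * g) * h := by simp only [Matrix.mul_assoc]
      _ = _ := by rw [hg, hh]
  have gt : ∀ m : ℤ, tUmat p m ∈ GUset s := by
    intro m
    have h1 : p ^ m * (p ^ m)⁻¹ = 1 := mul_inv_cancel₀ (zpow_ne_zero _ hp0)
    have h2 : (p ^ m)⁻¹ * p ^ m = 1 := inv_mul_cancel₀ (zpow_ne_zero _ hp0)
    ext i j
    fin_cases i <;> fin_cases j <;>
      simp [GUset, tUmat, J3mat, Matrix.mul_apply, Fin.sum_univ_three, hsp, h1, h2]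
  have gz : zUmat p ∈ GUset s := by
    ext i j
    fin_cases i <;> fin_cases j <;>
      simp [GUset, zUmat, J3mat, Matrix.mul_apply, Fin.sum_univ_three, hsp, hp0]
  have gu : ∀ x y, y + s y + x * s x = 0 → uM s x y ∈ GUset s := by
    intro x y h
    ext i j
    fin_cases i <;> fin_cases j <;>
      simp [GUset, uM, J3mat, Matrix.mul_apply, Fin.sum_univ_three, hσinvol]
    linear_combination h
  have guh : ∀ x y, y + s y + x * s x = 0 → uhatM s x y ∈ GUset s := by
    intro x y h
    ext i j
    fin_cases i <;> fin_cases j <;>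
      simp [GUset, uhatM, J3mat, Matrix.mul_apply, Fin.sum_univ_three, hσinvol]
    linear_combination h
  have hsq : ∀ x, -(x * s x) / 2 + s (-(x * s x) / 2) + x * s x = 0 := fun x => by
    simp only [map_div₀, map_neg, map_mul, hσinvol, map_ofNat]
    field_simp; ring
  have z0 : absE 0 = 0 := (habsE0 0).2 rfl
  have hQz : ∀ m : ℤ, (0:ℝ) ≤ (q ^ 2) ^ m := fun m => by positivity
  have hQn : (1:ℝ) ≤ (q ^ 2) ^ n := one_le_zpow₀ hQ1 (by linarith)
  have hQn1 : q ^ 2 ≤ (q ^ 2) ^ n := by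
    simpa using zpow_le_zpow_right₀ hQ1 (show (1:ℤ) ≤ n by linarith)
  have kt : tUmat p n ∈ KUset q s absE n := by
    refine ⟨gt n, ?_⟩
    have a := hpz n
    have b := hpz (-n)
    rw [neg_neg] at b
    have c := hQz (-n)
    refine ⟨?_, ?_, ?_, ?_, ?_, ?_, ?_, ?_, ?_⟩
    · simp [tUmat, z0]
    · simp [tUmat, z0]
    · exact b.le
    · simpa only [tUmat, Matrix.of_apply, Matrix.cons_val, z0] using c
    · simpa [tUmat, z0] using hQz n
    · simp [tUmat, z0]
    · exact a.le
    · simpa only [tUmat, Matrix.of_apply, Matrix.cons_val, z0] using c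
    · simp [tUmat, z0]
  have ku : ∀ x y, y + s y + x * s x = 0 → absE x ≤ 1 → absE y ≤ (q ^ 2) ^ n →
      uM s x y ∈ KUset q s absE n := by
    intro x y h hx hy
    have c := hQz n
    refine ⟨gu x y h, ?_, ?_, ?_, ?_, ?_, ?_, ?_, ?_, ?_⟩ <;>
      simp [uM, z0, hE1, hEneg, habsEconj, hx, hy, c]
  have key1 : ∀ y, tUmat p (n - 1) * uhatM s y (-(y * s y) / 2) * tUmat p n =
      zUmat p * uM s (-(p ^ (-n) * s y)) (-((-(p ^ (-n) * s y)) * s (-(p ^ (-n) * s y))) / 2) := by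
    intro y
    have e1 : p ^ (n - 1) = p ^ n * p⁻¹ := by rw [zpow_sub_one₀ hp0]
    have e2 : p ^ (-(n - 1)) = (p ^ n)⁻¹ * p := by rw [_root_.zpow_neg, e1, mul_inv, inv_inv]
    have hP : p ^ n ≠ 0 := zpow_ne_zero _ hp0
    ext i j
    fin_cases i <;> fin_cases j <;>
      simp [tUmat, uhatM, zUmat, uM, Matrix.mul_apply, Fin.sum_univ_three, hsp, e1, e2, hσinvol,
        -neg_sub] <;> field_simp
  have key2 : ∀ x x', uM s x' (-(x' * s x') / 2) = uM s x (-(x * s x) / 2) *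
      uM s (x' - x) (-(x' * s x') / 2 - -(x * s x) / 2 + x * s (x' - x)) := by
    intro x x'
    ext i j
    fin_cases i <;> fin_cases j <;>
      simp [uM, Matrix.mul_apply, Fin.sum_univ_three] <;> ring
  have step : ∀ y e, absE e ≤ q ^ 2 → absE (-(p ^ (-n) * s y)) ≤ q ^ 2 →
      absE (-(p ^ (-n) * s y) - e) ≤ 1 →
      ρ (tUmat p (n - 1) * uhatM s y (-(y * s y) / 2)) v =
      ρ (zUmat p * uM s e (-(e * s e) / 2)) v := by
    intro y e he hx hd
    have g1 := gmul _ (gt (n - 1)) _ (guh y _ (hsq y))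
    have s1 : ρ (tUmat p (n - 1) * uhatM s y (-(y * s y) / 2)) v =
        ρ (tUmat p (n - 1) * uhatM s y (-(y * s y) / 2) * tUmat p n) v := by
      rw [hρmul _ g1 _ (gt n), Module.End.mul_apply, hv _ kt]
    rw [s1, key1]
    generalize -(p ^ (-n) * s y) = x at *
    rw [key2 e x, ← Matrix.mul_assoc]
    have hk : uM s (x - e) (-(x * s x) / 2 - -(e * s e) / 2 + e * s (x - e)) ∈
        KUset q s absE n := by
      refine ku _ _ ?_ hd ?_
      · simp only [map_div₀, map_neg, map_mul, hσinvol, map_ofNat, map_sub, map_add]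
        field_simp; ring
      · -- rewrite so that the difference `d` occurs in each term
        have hy : -(x * s x) / 2 - -(e * s e) / 2 + e * s (x - e) =
            e * s (x - e) / 2 - (x - e) * s x / 2 := by
          simp only [map_sub]; field_simp; ring
        rw [hy]
        refine (hEsub _ _ (q ^ 2) ?_ ?_).trans hQn1
        · rw [hEhalf, habsEmul, habsEconj]
          nlinarith [hEnn e, hEnn (x - e)]
        · rw [hEhalf, habsEmul, habsEconj]
          nlinarith [hEnn x, hEnn (x - e)]
    rw [hρmul _ (gmul _ gz _ (gu _ _ (hsq e))) _ hk.1, Module.End.mul_apply, hv _ hk]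
  -- the bijection of representatives
  obtain ⟨w1, w2, w3⟩ := hwr
  obtain ⟨r1, r2, r3⟩ := her
  simp only [neg_neg, neg_zero, zpow_zero, zpow_one] at r1 r2 r3
  have hmulz : ∀ a b : ℤ, ((q ^ 2 : ℝ)) ^ a * (q ^ 2) ^ b = (q ^ 2) ^ (a + b) :=
    fun a b => (zpow_add₀ hQ0 a b).symm
  have habsx : ∀ y, absE (-(p ^ (-n) * s y)) = (q ^ 2) ^ n * absE y := fun y => by
    rw [hEneg, habsEmul, hpz, neg_neg, habsEconj]
  have hx : ∀ i, absE (-(p ^ (-n) * s (wr i))) ≤ q ^ 2 := fun i => by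
    rw [habsx]
    calc _ ≤ (q ^ 2) ^ n * (q ^ 2) ^ (-(n - 1)) := mul_le_mul_of_nonneg_left (w1 i) (hQz n)
      _ = q ^ 2 := by rw [hmulz]; simp
  choose f hf using fun i => r3 _ (hx i)
  refine Fintype.sum_bijective f ⟨?_, ?_⟩ _ _ fun i => step _ _ (r1 _) (hx i) (hf i)
  · intro i j hij
    apply w2
    have h := hEsub _ _ 1 (hf i) (hij ▸ hf j)
    have e : -(p ^ (-n) * s (wr i)) - er (f i) - (-(p ^ (-n) * s (wr j)) - er (f i)) =
        -(p ^ (-n) * s (wr i - wr j)) := by rw [map_sub]; ring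
    rw [e, habsx] at h
    rw [_root_.zpow_neg]
    exact (le_inv_mul_iff₀ (by positivity)).2 h |>.trans (by simp)
  · intro j
    have hy : absE (-(p ^ n * s (er j))) ≤ (q ^ 2) ^ (-(n - 1)) := by
      rw [hEneg, habsEmul, hpz, habsEconj]
      calc _ ≤ (q ^ 2) ^ (-n) * (q ^ 2) ^ (1:ℤ) := by
              rw [zpow_one]; exact mul_le_mul_of_nonneg_left (r1 j) (hQz _)
        _ = _ := by rw [hmulz]; congr 1; ring
    obtain ⟨i, hi⟩ := w3 _ hy
    refine ⟨i, (r2 _ _ ?_)⟩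
    have e : er (f i) - er j = -(-(p ^ (-n) * s (-(p ^ n * s (er j)) - wr i)))
        - (-(p ^ (-n) * s (wr i)) - er (f i)) := by
      have hP : p ^ n ≠ 0 := zpow_ne_zero _ hp0
      simp only [map_sub, map_neg, map_mul, hspz, hσinvol, _root_.zpow_neg]
      field_simp; ring
    rw [e]
    refine hEsub _ _ 1 ?_ (hf i)
    rw [hEneg, habsx]
    calc _ ≤ (q ^ 2) ^ n * (q ^ 2) ^ (-n) := mul_le_mul_of_nonneg_left hi (hQz n)
      _ = 1 := by rw [hmulz]; simp
end
end
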